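/- arXiv:1112.0128 — 3 statements merged into one kernel-verified Lean document; each statement's English description precedes it below -/
import Mathlib

section
/- Let n ≥ 2, let p be a prime, and let ψ : ℕ → [0,∞) be a decreasing (monotone nonincreasing) function. If the series Σ_{q=1}^∞ q^{n-1} ψ(q)^{n-1} diverges, then μ_p(W_p(ψ, ℚ, n)) = 1. -/
open MeasureTheory

noncomputable section

/-- The p-adic projective distance (at vector level): the sup-norm of the wedge product
divided by the product of sup norms.  Invariant under scaling, it descends to
projective space. -/
def padicDelta (p : ℕ) [Fact p.Prime] {n : ℕ} (x y : Fin n → ℚ_[p]) : ℝ :=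
  (⨆ ij : Fin n × Fin n, ‖x ij.1 * y ij.2 - x ij.2 * y ij.1‖) / (‖x‖ * ‖y‖)

instance (p : ℕ) [Fact p.Prime] (n : ℕ) : MeasurableSpace (Fin n → ℚ_[p]) := borel _
instance (p : ℕ) [Fact p.Prime] (n : ℕ) : BorelSpace (Fin n → ℚ_[p]) := ⟨rfl⟩

/-- `ℤ_p^n` as a positive compact subset of `ℚ_p^n`. -/
def padicUnitPC (p : ℕ) [Fact p.Prime] (n : ℕ) :
    TopologicalSpace.PositiveCompacts (Fin n → ℚ_[p]) where
  carrier := {x | ∀ i, ‖x i‖ ≤ 1}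
  isCompact' := by
    have : {x : Fin n → ℚ_[p] | ∀ i, ‖x i‖ ≤ 1} = Set.univ.pi fun _ => Metric.closedBall 0 1 := by
      ext x; simp [Metric.mem_closedBall, dist_eq_norm]
    rw [this]
    exact isCompact_univ_pi fun i => isCompact_closedBall 0 1
  interior_nonempty' := by
    refine ⟨0, ?_⟩
    rw [mem_interior]
    refine ⟨Metric.ball 0 1, fun x hx i => ?_, Metric.isOpen_ball, by simp⟩
    have hx' : ‖x‖ < 1 := by simpa [dist_eq_norm] using hx
    exact le_of_lt (lt_of_le_of_lt (norm_le_pi_norm x i) hx')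

/-- Haar measure on `ℚ_p^n`, normalized so that `ℤ_p^n` has measure one. -/
def padicHaar (p : ℕ) [Fact p.Prime] (n : ℕ) : Measure (Fin n → ℚ_[p]) :=
  Measure.addHaarMeasure (padicUnitPC p n)

/-- The natural probability measure `μ_p` on `ℙ^{n-1}(ℚ_p)`:
`μ_p(M) = β(φ⁻¹(M) ∩ ℤ_p^n)`. -/
def muP (p : ℕ) [Fact p.Prime] (n : ℕ)
    (M : Set (Projectivization ℚ_[p] (Fin n → ℚ_[p]))) : ENNReal :=
  padicHaar p n {x | (∀ i, ‖x i‖ ≤ 1) ∧ ∃ hx : x ≠ 0, Projectivization.mk ℚ_[p] x hx ∈ M}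

/-- A visible (primitive) integer vector: the gcd of its coordinates is 1. -/
def IsPrim {n : ℕ} (v : Fin n → ℤ) : Prop := Finset.univ.gcd v = 1

/-- The sup-norm height of an integer vector. -/
def Hsup {n : ℕ} (v : Fin n → ℤ) : ℕ := Finset.univ.sup fun i => (v i).natAbs

/-- Embedding of an integer vector into `ℚ_p^n`. -/
def intPadic (p : ℕ) [Fact p.Prime] {n : ℕ} (v : Fin n → ℤ) : Fin n → ℚ_[p] :=
  fun i => ((v i : ℤ) : ℚ_[p])

/-- Embedding of an integer vector into `ℚ^n`. -/
def intRat {n : ℕ} (v : Fin n → ℤ) : Fin n → ℚ := fun i => ((v i : ℤ) : ℚ)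

/-- The set `W_p(ψ, ℚ, n)` of points of `ℙ^{n-1}(ℚ_p)` admitting infinitely many
rational approximations `y` with `δ_p(x,y) ≤ ψ(H(y))`. -/
def Wp (p : ℕ) [Fact p.Prime] (n : ℕ) (ψ : ℕ → ℝ) :
    Set (Projectivization ℚ_[p] (Fin n → ℚ_[p])) :=
  {x | {y : Projectivization ℚ (Fin n → ℚ) | ∃ v : Fin n → ℤ, IsPrim v ∧
      (∃ hv : intRat v ≠ 0, y = Projectivization.mk ℚ (intRat v) hv) ∧
      padicDelta p x.rep (intPadic p v) ≤ ψ (Hsup v)}.Infinite}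

/-- Closed ball for the projective metric, centered at the class of the vector `y`. -/
def Bdelta (p : ℕ) [Fact p.Prime] {n : ℕ} (y : Fin n → ℚ_[p]) (r : ℝ) :
    Set (Projectivization ℚ_[p] (Fin n → ℚ_[p])) :=
  {z | padicDelta p z.rep y ≤ r}

/-- The Euclidean norm of a vector in `ℝ^n`. -/
noncomputable def eNorm {n : ℕ} (x : Fin n → ℝ) : ℝ := Real.sqrt (∑ i, (x i) ^ 2)

/-- Norm of the wedge product of two vectors in `ℝ^n`:
`‖x ∧ y‖² = Σ_{i<j} (x_i y_j − x_j y_i)²`. -/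
noncomputable def wedgeNorm {n : ℕ} (x y : Fin n → ℝ) : ℝ :=
  Real.sqrt (∑ ij ∈ Finset.univ.filter (fun ij : Fin n × Fin n => ij.1 < ij.2),
    (x ij.1 * y ij.2 - x ij.2 * y ij.1) ^ 2)

/-- The projective distance at the infinite place (vector level):
`δ_∞(x,y) = ‖x ∧ y‖ / (‖x‖‖y‖)`. Invariant under scaling, it descends to `ℙ^{n-1}(ℝ)`. -/
noncomputable def deltaInf {n : ℕ} (x y : Fin n → ℝ) : ℝ :=
  wedgeNorm x y / (eNorm x * eNorm y)

/-- Embedding of an integer vector into `ℝ^n`. -/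
noncomputable def intReal {n : ℕ} (v : Fin n → ℤ) : Fin n → ℝ := fun i => ((v i : ℤ) : ℝ)

/-- The natural probability measure `μ_∞` on `ℙ^{n-1}(ℝ)`:
`μ_∞(M) = λ(φ⁻¹(M) ∩ B(0,1)) / λ(B(0,1))`. -/
noncomputable def muInf (n : ℕ) (M : Set (Projectivization ℝ (Fin n → ℝ))) : ENNReal :=
  MeasureTheory.volume {x : Fin n → ℝ | eNorm x ≤ 1 ∧
      ∃ hx : x ≠ 0, Projectivization.mk ℝ x hx ∈ M} /
    MeasureTheory.volume {x : Fin n → ℝ | eNorm x ≤ 1}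

/-- The set `W_∞(ψ, ℚ, n)` of points of `ℙ^{n-1}(ℝ)` admitting infinitely many
rational approximations `y` with `δ_∞(x,y) ≤ ψ(H(y))`. -/
noncomputable def Winf (n : ℕ) (ψ : ℕ → ℝ) : Set (Projectivization ℝ (Fin n → ℝ)) :=
  {x | {y : Projectivization ℚ (Fin n → ℚ) | ∃ v : Fin n → ℤ, IsPrim v ∧
      (∃ hv : intRat v ≠ 0, y = Projectivization.mk ℚ (intRat v) hv) ∧
      deltaInf x.rep (intReal v) ≤ ψ (Hsup v)}.Infinite}

/-- The Choi–Vaaler constant `c(n) = 2·π^{-1/2}·Γ(n/2+1)^{1/n}` for `k = ℚ`. -/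
noncomputable def cCV (n : ℕ) : ℝ :=
  2 * Real.pi ^ (-(1/2 : ℝ)) * Real.Gamma ((n : ℝ) / 2 + 1) ^ ((1 : ℝ) / n)

/-- The Euclidean height of a primitive integer vector. -/
noncomputable def He {n : ℕ} (v : Fin n → ℤ) : ℝ := eNorm (intReal v)

end

section Invariance

variable {G ι : Type*} [AddGroup G] [MeasurableSpace G] [MeasurableAdd G] [Fintype ι]

theorem card_mul_measure_le_of_translates_disjoint (μ : Measure G) [μ.IsAddLeftInvariant]
    {S T : Set G} (hS : MeasurableSet S) (a : ι → G)
    (hdisj : ∀ i j, ∀ s ∈ S, ∀ t ∈ S, a i + s = a j + t → i = j)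
    (hsub : ∀ i, ∀ s ∈ S, a i + s ∈ T) : Fintype.card ι * μ S ≤ μ T := by
  have h : ∀ i, μ ((fun x => -a i + x) ⁻¹' S) = μ S := fun i => measure_preimage_add μ (-a i) S
  have hm : ∀ i, MeasurableSet ((fun x => -a i + x) ⁻¹' S) := fun i => measurable_const_add _ hS
  have hd : Pairwise (Function.onFun Disjoint fun i => (fun x => -a i + x) ⁻¹' S) := by
    intro i j hij
    refine Set.disjoint_left.2 fun x hx hx' => hij ?_
    exact hdisj i j _ hx _ hx' (by simp)
  calc Fintype.card ι * μ S = ∑ i : ι, μ ((fun x => -a i + x) ⁻¹' S) := by simp [h]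
    _ = μ (⋃ i, (fun x => -a i + x) ⁻¹' S) := by
      rw [measure_iUnion hd hm, tsum_fintype]
    _ ≤ μ T := by
      refine measure_mono (Set.iUnion_subset fun i x hx => ?_)
      simpa using hsub i _ hx

theorem measure_le_card_mul_of_translates_cover (μ : Measure G) [μ.IsAddLeftInvariant]
    {S T : Set G} (a : ι → G) (hcover : ∀ x ∈ T, ∃ i, -a i + x ∈ S) :
    μ T ≤ Fintype.card ι * μ S := by
  have h : ∀ i, μ ((fun x => -a i + x) ⁻¹' S) = μ S := fun i => measure_preimage_add μ (-a i) S
  calc μ T ≤ μ (⋃ i, (fun x => -a i + x) ⁻¹' S) := by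
        refine measure_mono fun x hx => ?_
        simpa using hcover x hx
    _ ≤ ∑ i : ι, μ ((fun x => -a i + x) ⁻¹' S) := measure_iUnion_fintype_le _ _
    _ = Fintype.card ι * μ S := by simp [h]

end Invariance

/-- Two vectors are projectively `r`-close: the denominator-free form of `padicDelta p x z ≤ r`. -/
def PadicNear (p : ℕ) [Fact p.Prime] {n : ℕ} (r : ℝ) (x z : Fin n → ℚ_[p]) : Prop :=
  ∀ i j, ‖x i * z j - x j * z i‖ ≤ r * (‖x‖ * ‖z‖)

section Near

variable {p : ℕ} [Fact p.Prime] {n : ℕ} {r s : ℝ} {x y z : Fin n → ℚ_[p]}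

theorem exists_norm_apply_eq_norm (hx : x ≠ 0) : ∃ k, ‖x k‖ = ‖x‖ := by
  obtain ⟨i, hi⟩ := Function.ne_iff.1 hx
  obtain ⟨k, -, hk⟩ := Finset.exists_max_image Finset.univ (fun i => ‖x i‖) ⟨i, Finset.mem_univ i⟩
  exact ⟨k, le_antisymm (norm_le_pi_norm x k)
    ((pi_norm_le_iff_of_nonneg (norm_nonneg _)).2 fun i => hk i (Finset.mem_univ i))⟩

theorem padic_norm_sub_le {a b : ℚ_[p]} {c : ℝ} (ha : ‖a‖ ≤ c) (hb : ‖b‖ ≤ c) : ‖a - b‖ ≤ c := by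
  rw [sub_eq_add_neg]
  exact (Padic.nonarchimedean _ _).trans (max_le ha (by rwa [norm_neg]))

theorem padic_norm_add_le {a b : ℚ_[p]} {c : ℝ} (ha : ‖a‖ ≤ c) (hb : ‖b‖ ≤ c) : ‖a + b‖ ≤ c :=
  (Padic.nonarchimedean _ _).trans (max_le ha hb)

namespace PadicNear

theorem symm (h : PadicNear p r x y) : PadicNear p r y x := by
  intro i j
  have := h j i
  rw [mul_comm ‖y‖]
  convert this using 2
  ring

theorem mono (hrs : r ≤ s) (h : PadicNear p r x y) : PadicNear p s x y := fun i j =>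
  (h i j).trans (by gcongr)

theorem trans (hy : y ≠ 0) (hxy : PadicNear p r x y) (hyz : PadicNear p r y z) :
    PadicNear p r x z := by
  obtain ⟨k, hk⟩ := exists_norm_apply_eq_norm hy
  have hy' : 0 < ‖y‖ := norm_pos_iff.2 hy
  intro i j
  refine le_of_mul_le_mul_left ?_ hy'
  rw [← hk, ← norm_mul]
  have key : y k * (x i * z j - x j * z i)
      = z j * (x i * y k - x k * y i) - z i * (x j * y k - x k * y j)
        + x k * (y i * z j - y j * z i) := by ring
  have e : ‖y k‖ * (r * (‖x‖ * ‖z‖)) = ‖z‖ * (r * (‖x‖ * ‖y‖)) := by rw [hk]; ring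
  have e' : ‖z‖ * (r * (‖x‖ * ‖y‖)) = ‖x‖ * (r * (‖y‖ * ‖z‖)) := by ring
  rw [key, e]
  have hb : ∀ (a : Fin n → ℚ_[p]) (c : ℚ_[p]) (R : ℝ) (t : Fin n), ‖c‖ ≤ R →
      ‖a t * c‖ ≤ ‖a‖ * R := by
    intro a c R t hc
    rw [norm_mul]
    exact mul_le_mul (norm_le_pi_norm a t) hc (norm_nonneg _) (norm_nonneg _)
  refine padic_norm_add_le (padic_norm_sub_le ?_ ?_) ?_
  · exact hb z _ _ _ (hxy i k)
  · exact hb z _ _ _ (hxy j k)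
  · rw [e']
    exact hb x _ _ _ (hyz i j)

theorem smul_left (c : ℚ_[p]) (h : PadicNear p r x y) : PadicNear p r (c • x) y := by
  intro i j
  have e : (c • x) i * y j - (c • x) j * y i = c * (x i * y j - x j * y i) := by
    simp only [Pi.smul_apply, smul_eq_mul]; ring
  rw [e, norm_mul, norm_smul]
  calc ‖c‖ * ‖x i * y j - x j * y i‖ ≤ ‖c‖ * (r * (‖x‖ * ‖y‖)) := by gcongr; exact h i j
    _ = r * (‖c‖ * ‖x‖ * ‖y‖) := by ring

theorem smul_right (c : ℚ_[p]) (h : PadicNear p r x y) : PadicNear p r x (c • y) :=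
  (h.symm.smul_left c).symm

/-- It suffices to compare the coordinates in an affine chart around `x`. -/
theorem of_chart {k : Fin n} (hk : ‖x k‖ = ‖x‖) (hx : x ≠ 0)
    (h : ∀ i, ‖x i * z k - x k * z i‖ ≤ r * (‖x‖ * ‖z‖)) : PadicNear p r x z := by
  have hx' : 0 < ‖x‖ := norm_pos_iff.2 hx
  intro i j
  refine le_of_mul_le_mul_left ?_ hx'
  have key : x k * (x i * z j - x j * z i)
      = x j * (x i * z k - x k * z i) - x i * (x j * z k - x k * z j) := by ring
  conv_lhs => rw [← hk, ← norm_mul, key]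
  refine padic_norm_sub_le ?_ ?_ <;> rw [norm_mul] <;>
    exact mul_le_mul (norm_le_pi_norm x _) (h _) (norm_nonneg _) (norm_nonneg _)

theorem padicDelta_le (hr : 0 ≤ r) (h : PadicNear p r x z) : padicDelta p x z ≤ r := by
  have hsup : (⨆ ij : Fin n × Fin n, ‖x ij.1 * z ij.2 - x ij.2 * z ij.1‖) ≤ r * (‖x‖ * ‖z‖) :=
    Real.iSup_le (fun ij => h ij.1 ij.2) (by positivity)
  exact div_le_of_le_mul₀ (by positivity) hr hsup

end PadicNear

theorem isClosed_setOf_padicNear (r : ℝ) (z : Fin n → ℚ_[p]) :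
    IsClosed {x : Fin n → ℚ_[p] | PadicNear p r x z} := by
  simp only [PadicNear, Set.ofPred_forall]
  exact isClosed_iInter fun i => isClosed_iInter fun j =>
    isClosed_le (by fun_prop) (by fun_prop)

end Near

/-- The cone over the projective ball of radius `p ^ (-j)` around the class of `z`. -/
def padicCone (p : ℕ) [Fact p.Prime] {n : ℕ} (j : ℕ) (z : Fin n → ℚ_[p]) :
    Set (Fin n → ℚ_[p]) :=
  {x | x ≠ 0 ∧ PadicNear p ((p : ℝ)⁻¹ ^ j) x z}

/-- Haar measure restricted to `ℤ_p^n`. -/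
noncomputable def padicUnitMeasure (p : ℕ) [Fact p.Prime] (n : ℕ) : Measure (Fin n → ℚ_[p]) :=
  (padicHaar p n).restrict {x | ∀ i, ‖x i‖ ≤ 1}

section Cone

variable {p : ℕ} [Fact p.Prime] {n : ℕ} {z w : Fin n → ℚ_[p]} {i j : ℕ}

theorem inv_prime_pos (p : ℕ) [hp : Fact p.Prime] : (0 : ℝ) < (p : ℝ)⁻¹ :=
  inv_pos.2 (Nat.cast_pos.2 hp.out.pos)

theorem inv_prime_le_half (p : ℕ) [hp : Fact p.Prime] : (p : ℝ)⁻¹ ≤ 1 / 2 := by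
  rw [one_div]
  exact inv_anti₀ two_pos (by exact_mod_cast hp.out.two_le)

theorem inv_prime_lt_one (p : ℕ) [Fact p.Prime] : (p : ℝ)⁻¹ < 1 :=
  (inv_prime_le_half p).trans_lt (by norm_num)

theorem padicCone_anti (hij : i ≤ j) : padicCone p j z ⊆ padicCone p i z := fun _ hx =>
  ⟨hx.1, hx.2.mono (pow_le_pow_of_le_one (inv_prime_pos p).le (inv_prime_lt_one p).le hij)⟩

theorem padicCone_subset_of_mem {x : Fin n → ℚ_[p]} (hw : w ≠ 0)
    (hz : x ∈ padicCone p j z) (hx : x ∈ padicCone p j w) : padicCone p j w ⊆ padicCone p j z :=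
  fun _ hy => ⟨hy.1, hy.2.trans hw (hx.2.symm.trans hx.1 hz.2)⟩

theorem measurableSet_padicCone : MeasurableSet (padicCone p j z) :=
  (measurableSet_singleton (0 : Fin n → ℚ_[p])).compl.inter
    (isClosed_setOf_padicNear _ z).measurableSet

instance : (padicHaar p n).IsAddHaarMeasure := by
  unfold padicHaar; infer_instance

theorem measurableSet_padicUnit : MeasurableSet {x : Fin n → ℚ_[p] | ∀ i, ‖x i‖ ≤ 1} :=
  (padicUnitPC p n).isCompact.isClosed.measurableSet

theorem padicHaar_unit : padicHaar p n {x | ∀ i, ‖x i‖ ≤ 1} = 1 :=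
  Measure.addHaarMeasure_self (K₀ := padicUnitPC p n)

instance : IsProbabilityMeasure (padicUnitMeasure p n) :=
  ⟨by rw [padicUnitMeasure, Measure.restrict_apply_univ, padicHaar_unit]⟩

theorem card_chart {p n : ℕ} (k : Fin n) (j : ℕ) :
    (Fintype.card ({i : Fin n // i ≠ k} → Fin (p ^ j)) : ℝ) = ((p : ℝ) ^ j) ^ (n - 1) := by
  simp [Fintype.card_subtype_compl]

/-- The vector with coordinate `0` at `k` and coordinates `a` elsewhere. -/
noncomputable def chartVector (p : ℕ) [Fact p.Prime] (k : Fin n)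
    (a : {i : Fin n // i ≠ k} → Fin (p ^ j)) : Fin n → ℚ_[p] :=
  fun i => if h : i = k then 0 else (((a ⟨i, h⟩ : ℕ)) : ℚ_[p])

theorem norm_natCast_sub_le_iff (a b : Fin (p ^ j)) :
    ‖((a : ℕ) : ℚ_[p]) - ((b : ℕ) : ℚ_[p])‖ ≤ (p : ℝ)⁻¹ ^ j ↔ a = b := by
  have e : ((a : ℕ) : ℚ_[p]) - ((b : ℕ) : ℚ_[p]) = (((a : ℕ) - (b : ℕ) : ℤ) : ℚ_[p]) := by
    push_cast; rfl
  have e' : (p : ℝ)⁻¹ ^ j = (p : ℝ) ^ (-(j : ℤ)) := by simp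
  rw [e, e', Padic.norm_int_le_pow_iff_dvd]
  refine ⟨fun h => ?_, fun h => by simp [h]⟩
  have h2 : ((b : ℕ) : ℤ) ≡ ((a : ℕ) : ℤ) [ZMOD ((p ^ j : ℕ) : ℤ)] :=
    Int.modEq_iff_dvd.2 (by exact_mod_cast h)
  have h3 := (Int.natCast_modEq_iff.1 h2)
  exact Fin.ext (Nat.ModEq.eq_of_lt_of_lt h3 b.2 a.2).symm

theorem norm_natCast_le_one (a : ℕ) : ‖(a : ℚ_[p])‖ ≤ 1 := by
  exact_mod_cast Padic.norm_int_le_one (p := p) a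

theorem exists_norm_sub_natCast_le {x : ℚ_[p]} (hx : ‖x‖ ≤ 1) (j : ℕ) :
    ∃ a : Fin (p ^ j), ‖x - ((a : ℕ) : ℚ_[p])‖ ≤ (p : ℝ)⁻¹ ^ j := by
  obtain ⟨y, rfl⟩ : ∃ y : ℤ_[p], (y : ℚ_[p]) = x := ⟨⟨x, hx⟩, rfl⟩
  refine ⟨⟨y.appr j, PadicInt.appr_lt _ _⟩, ?_⟩
  have h := (PadicInt.norm_le_pow_iff_mem_span_pow _ _).2 (PadicInt.appr_spec j y)
  rw [PadicInt.norm_def, PadicInt.coe_sub, PadicInt.coe_natCast] at h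
  simpa only [inv_pow, zpow_neg, zpow_natCast] using h

theorem isClosed_chartBall (c : ℝ) (k : Fin n) (t : Fin n → ℚ_[p]) :
    IsClosed {x : Fin n → ℚ_[p] | (∀ i, ‖x i‖ ≤ 1) ∧ ∀ i, ‖x i - x k * t i‖ ≤ c} := by
  have h : IsClosed {x : Fin n → ℚ_[p] | ∀ i, ‖x i - x k * t i‖ ≤ c} := by
    rw [Set.ofPred_forall]
    exact isClosed_iInter fun i => isClosed_le (by fun_prop) (by fun_prop)
  exact IsClosed.inter (padicUnitPC p n).isCompact.isClosed h

theorem measurableSet_padicNear (r : ℝ) : MeasurableSet {x | PadicNear p r x z} :=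
  (isClosed_setOf_padicNear _ z).measurableSet

theorem measureReal_padicNear_le (hz : z ≠ 0) (j : ℕ) :
    (padicUnitMeasure p n).real {x | PadicNear p ((p : ℝ)⁻¹ ^ j) x z}
      ≤ ((p : ℝ)⁻¹ ^ j) ^ (n - 1) := by
  obtain ⟨k, hk⟩ := exists_norm_apply_eq_norm hz
  have hz' : 0 < ‖z‖ := norm_pos_iff.2 hz
  have hzk : z k ≠ 0 := by rw [← norm_pos_iff, hk]; exact hz'
  set S : Set (Fin n → ℚ_[p]) :=
    {x | (∀ i, ‖x i‖ ≤ 1) ∧ ∀ i, ‖x i - x k * (z i / z k)‖ ≤ (p : ℝ)⁻¹ ^ j} with hSdef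
  have hS : MeasurableSet S := (isClosed_chartBall _ k _).measurableSet
  have hsub : {x | PadicNear p ((p : ℝ)⁻¹ ^ j) x z} ∩ {x | ∀ i, ‖x i‖ ≤ 1} ⊆ S := by
    rintro x ⟨hx, hx1⟩
    refine ⟨hx1, fun i => ?_⟩
    have e : x i - x k * (z i / z k) = (x i * z k - x k * z i) / z k := by field_simp
    rw [e, norm_div, hk, div_le_iff₀ hz']
    refine (hx i k).trans ?_
    have : ‖x‖ ≤ 1 := (pi_norm_le_iff_of_nonneg zero_le_one).2 hx1
    have h0 := inv_prime_pos p
    gcongr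
    exact mul_le_of_le_one_left hz'.le this
  have hcard := card_mul_measure_le_of_translates_disjoint (padicHaar p n)
    (T := {x | ∀ i, ‖x i‖ ≤ 1}) hS (chartVector (j := j) p k) ?_ ?_
  · rw [padicHaar_unit] at hcard
    have hfin : padicHaar p n S ≠ ⊤ :=
      ((measure_mono (fun x hx => hx.1)).trans_lt
        (padicHaar_unit (p := p) (n := n) ▸ ENNReal.one_lt_top)).ne
    have hreal := ENNReal.toReal_mono ENNReal.one_ne_top hcard
    rw [ENNReal.toReal_mul, ENNReal.toReal_natCast, card_chart, ENNReal.toReal_one] at hreal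
    have h1 : (padicUnitMeasure p n).real {x | PadicNear p ((p : ℝ)⁻¹ ^ j) x z}
        ≤ (padicHaar p n S).toReal := by
      rw [measureReal_def, padicUnitMeasure, Measure.restrict_apply (measurableSet_padicNear _)]
      exact ENNReal.toReal_mono hfin (measure_mono hsub)
    refine h1.trans ?_
    rw [inv_pow, inv_pow, ← one_div, le_div_iff₀ (by have := inv_pos.1 (inv_prime_pos p); positivity),
      mul_comm]
    · exact hreal
  · intro a b s hs t ht hst
    have hsk : s k = t k := by simpa [chartVector] using congrFun hst k
    funext ⟨i, hi⟩
    rw [← norm_natCast_sub_le_iff (p := p)]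
    have hi' := congrFun hst i
    simp only [Pi.add_apply, chartVector, hi, dite_false] at hi'
    have e : (((a ⟨i, hi⟩ : Fin _) : ℕ) : ℚ_[p]) - ((b ⟨i, hi⟩ : Fin _) : ℕ)
        = (t i - t k * (z i / z k)) - (s i - s k * (z i / z k)) := by
      rw [hsk]; linear_combination hi'
    rw [e]
    exact padic_norm_sub_le (ht.2 i) (hs.2 i)
  · intro a s hs i
    refine padic_norm_add_le ?_ (hs.1 i)
    by_cases h : i = k
    · simp [chartVector, h]
    · simpa [chartVector, h] using norm_natCast_le_one _

theorem measureReal_padicCone_le (hz : z ≠ 0) (j : ℕ) :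
    (padicUnitMeasure p n).real (padicCone p j z) ≤ ((p : ℝ)⁻¹ ^ j) ^ (n - 1) :=
  (measureReal_mono fun _ hx => hx.2).trans (measureReal_padicNear_le hz j)

theorem measure_padicNear_zero (hn : 2 ≤ n) (hz : z ≠ 0) :
    padicUnitMeasure p n {x | PadicNear p 0 x z} = 0 := by
  rw [← measureReal_eq_zero_iff]
  refine le_antisymm (ge_of_tendsto' (x := Filter.atTop)
    (f := fun j : ℕ => ((p : ℝ)⁻¹ ^ j) ^ (n - 1)) ?_ fun j => ?_) measureReal_nonneg
  · have h := (tendsto_pow_atTop_nhds_zero_of_lt_one (inv_prime_pos p).le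
      (inv_prime_lt_one p)).pow (n - 1)
    rwa [zero_pow (by omega)] at h
  · exact (measureReal_mono fun x hx => hx.mono (pow_nonneg (inv_prime_pos p).le j)).trans
      (measureReal_padicNear_le hz j)

/-- Cones over balls of radius `p ^ (-j)` have measure at least a constant times
`p ^ (-j (n - 1))`. -/
theorem le_measureReal_padicCone (hz : z ≠ 0) (j : ℕ) :
    (padicHaar p n).real (Metric.ball 0 1) * ((p : ℝ)⁻¹ ^ j) ^ (n - 1)
      ≤ (padicUnitMeasure p n).real (padicCone p j z) := by
  obtain ⟨k, hk⟩ := exists_norm_apply_eq_norm hz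
  have hz' : 0 < ‖z‖ := norm_pos_iff.2 hz
  have hzk : z k ≠ 0 := by rw [← norm_pos_iff, hk]; exact hz'
  have hp := inv_prime_pos p
  have ht : ∀ i, ‖z i / z k‖ ≤ 1 := fun i => by
    rw [norm_div, hk, div_le_one hz']; exact norm_le_pi_norm z i
  set e : Fin n → ℚ_[p] := Pi.single k 1
  have hcover := measure_le_card_mul_of_translates_cover (padicHaar p n)
    (S := padicCone p j z ∩ {x | ∀ i, ‖x i‖ ≤ 1}) (T := (fun x => -e + x) ⁻¹' Metric.ball 0 1)
    (chartVector (j := j) p k) ?_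
  · rw [measure_preimage_add] at hcover
    have e1 : padicHaar p n (padicCone p j z ∩ {x | ∀ i, ‖x i‖ ≤ 1})
        = padicUnitMeasure p n (padicCone p j z) := by
      rw [padicUnitMeasure, Measure.restrict_apply measurableSet_padicCone]
    rw [e1] at hcover
    have hreal := ENNReal.toReal_mono
      (ENNReal.mul_ne_top (ENNReal.natCast_ne_top _) (measure_ne_top _ _)) hcover
    rw [ENNReal.toReal_mul, ENNReal.toReal_natCast, card_chart] at hreal
    rw [inv_pow, inv_pow, ← div_eq_mul_inv, div_le_iff₀ (by have := inv_pos.1 hp; positivity),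
      mul_comm]
    exact hreal
  · intro x hx
    rw [Set.mem_preimage, mem_ball_zero_iff] at hx
    have hxi : ∀ i, ‖-e i + x i‖ < 1 := fun i =>
      (norm_le_pi_norm (-e + x) i).trans_lt hx
    have hx1 : ∀ i, ‖x i‖ ≤ 1 := fun i => by
      have : x i = e i + (-e i + x i) := by ring
      rw [this]
      refine padic_norm_add_le ?_ (hxi i).le
      by_cases h : i = k
      · subst h; simp [e]
      · simp [e, h]
    have hxk : ‖x k‖ = 1 := by
      have h1 := hxi k
      simp only [e, Pi.single_eq_same] at h1
      have : ‖(1 : ℚ_[p]) + (-1 + x k)‖ = max ‖(1 : ℚ_[p])‖ ‖-1 + x k‖ :=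
        Padic.add_eq_max_of_ne (by simpa using h1.ne')
      simpa [h1.le] using this
    have hy : ∀ i, ‖x i - x k * (z i / z k)‖ ≤ 1 := fun i =>
      padic_norm_sub_le (hx1 i) (by simpa only [norm_mul, hxk, one_mul] using ht i)
    choose b hb using fun i => exists_norm_sub_natCast_le (hy i) j
    refine ⟨fun i => b i, ?_⟩
    set y := -chartVector (j := j) p k (fun i => b i) + x with hydef
    have hyk : y k = x k := by simp [hydef, chartVector]
    have hy1 : ∀ i, ‖y i‖ ≤ 1 := by
      intro i
      by_cases h : i = k
      · rw [h, hyk]; exact hx1 k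
      · simp only [hydef, Pi.add_apply, Pi.neg_apply, chartVector, h, dite_false]
        exact padic_norm_add_le (by rw [norm_neg]; exact norm_natCast_le_one _) (hx1 i)
    have hynorm : ‖y‖ = 1 := le_antisymm ((pi_norm_le_iff_of_nonneg zero_le_one).2 hy1)
      (by rw [← hxk, ← hyk]; exact norm_le_pi_norm y k)
    have hy0 : y ≠ 0 := by rw [← norm_pos_iff, hynorm]; exact one_pos
    refine ⟨⟨hy0, PadicNear.of_chart (k := k) (by rw [hyk, hxk, hynorm]) hy0 fun i => ?_⟩, hy1⟩
    by_cases h : i = k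
    · rw [h, sub_self, norm_zero]; positivity
    · have e2 : y i * z k - y k * z i = (x i - x k * (z i / z k) - ((b i : ℕ) : ℚ_[p])) * z k := by
        rw [hyk]
        simp only [hydef, Pi.add_apply, Pi.neg_apply, chartVector, h, dite_false]
        field_simp
        ring
      rw [e2, norm_mul, hk, hynorm, one_mul]
      gcongr
      exact hb i

end Cone

section Dirichlet

variable {p : ℕ} [Fact p.Prime] {n : ℕ}

theorem IsPrim.ne_zero {v : Fin n → ℤ} (hv : IsPrim v) : v ≠ 0 := by
  rintro rfl
  have : Finset.univ.gcd (0 : Fin n → ℤ) = 0 := Finset.gcd_eq_zero_iff.2 fun _ _ => rfl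
  rw [IsPrim, this] at hv
  exact zero_ne_one hv

theorem intRat_ne_zero {v : Fin n → ℤ} (hv : v ≠ 0) : intRat v ≠ 0 := by
  obtain ⟨i, hi⟩ := Function.ne_iff.1 hv
  exact Function.ne_iff.2 ⟨i, by simpa [intRat] using hi⟩

theorem intPadic_ne_zero {v : Fin n → ℤ} (hv : v ≠ 0) : intPadic p v ≠ 0 := by
  obtain ⟨i, hi⟩ := Function.ne_iff.1 hv
  exact Function.ne_iff.2 ⟨i, by simpa [intPadic] using hi⟩

theorem IsPrim.norm_intPadic {v : Fin n → ℤ} (hv : IsPrim v) : ‖intPadic p v‖ = 1 := by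
  have hp : p.Prime := Fact.out
  refine le_antisymm ((pi_norm_le_iff_of_nonneg zero_le_one).2 fun i => Padic.norm_int_le_one _) ?_
  by_contra! h
  have hdvd : (p : ℤ) ∣ Finset.univ.gcd v := Finset.dvd_gcd fun i _ =>
    (Padic.norm_intCast_lt_one_iff (p := p)).1 ((norm_le_pi_norm (intPadic p v) i).trans_lt h)
  rw [hv] at hdvd
  exact hp.one_lt.ne' (by exact_mod_cast Int.eq_one_of_dvd_one (by positivity) hdvd)

open Classical in
/-- The primitive integer vectors of height at most `Q`. -/
noncomputable def boundedPrim (n Q : ℕ) : Finset (Fin n → ℤ) :=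
  (Fintype.piFinset fun _ => Finset.Icc (-Q : ℤ) Q).filter IsPrim

theorem mem_boundedPrim {Q : ℕ} {v : Fin n → ℤ} :
    v ∈ boundedPrim n Q ↔ (∀ i, |v i| ≤ Q) ∧ IsPrim v := by
  simp [boundedPrim, abs_le]

theorem card_boundedPrim_le (n Q : ℕ) : (boundedPrim n Q).card ≤ (2 * Q + 1) ^ n := by
  classical
  refine (Finset.card_filter_le _ _).trans ?_
  have : ((Q : ℤ) + 1 + Q).toNat = 2 * Q + 1 := by omega
  simp [this]

theorem boundedPrim_mono {Q R : ℕ} (h : Q ≤ R) : boundedPrim n Q ⊆ boundedPrim n R := by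
  intro v hv
  rw [mem_boundedPrim] at hv ⊢
  exact ⟨fun i => (hv.1 i).trans (by exact_mod_cast h), hv.2⟩

theorem Hsup_le_of_mem_boundedPrim {Q : ℕ} {v : Fin n → ℤ} (hv : v ∈ boundedPrim n Q) :
    Hsup v ≤ Q :=
  Finset.sup_le fun i _ => by
    have := (mem_boundedPrim.1 hv).1 i
    rw [abs_le] at this
    omega

/-- A `p`-adic Dirichlet theorem. -/
theorem exists_int_vector_near {x : Fin n → ℚ_[p]} (hx : x ≠ 0) {m Q : ℕ}
    (hQ : (p ^ m) ^ (n - 1) < (Q + 1) ^ n) :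
    ∃ v : Fin n → ℤ, v ≠ 0 ∧ (∀ i, |v i| ≤ Q) ∧
      ∀ i j, ‖x i * v j - x j * v i‖ ≤ (p : ℝ)⁻¹ ^ m * ‖x‖ := by
  obtain ⟨k, hk⟩ := exists_norm_apply_eq_norm hx
  have hx' : 0 < ‖x‖ := norm_pos_iff.2 hx
  have hxk : x k ≠ 0 := by rw [← norm_pos_iff, hk]; exact hx'
  have hp : p.Prime := Fact.out
  have : NeZero (p ^ m) := ⟨(pow_pos hp.pos m).ne'⟩
  have ht : ∀ i, ‖x i / x k‖ ≤ 1 := fun i => by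
    rw [norm_div, hk, div_le_one hx']; exact norm_le_pi_norm x i
  let t : Fin n → ℤ_[p] := fun i => ⟨x i / x k, ht i⟩
  have htx : ∀ i, (t i : ℚ_[p]) * x k = x i := fun i => div_mul_cancel₀ _ hxk
  let f : (Fin n → Fin (Q + 1)) → {i : Fin n // i ≠ k} → ZMod (p ^ m) := fun u i =>
    PadicInt.toZModPow m (t i * ((u k : ℕ) : ℤ_[p]) - ((u i : ℕ) : ℤ_[p]))
  obtain ⟨u, u', huu, hf⟩ := Fintype.exists_ne_map_eq_of_card_lt f (by
    simpa [Fintype.card_subtype_compl] using hQ)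
  refine ⟨fun i => (u i : ℕ) - (u' i : ℕ), ?_, ?_, ?_⟩
  · obtain ⟨i, hi⟩ := Function.ne_iff.1 huu
    refine Function.ne_iff.2 ⟨i, ?_⟩
    have : (u i : ℕ) ≠ u' i := fun h => hi (Fin.ext h)
    simp only [Pi.zero_apply]
    omega
  · intro i
    have h1 := (u i).2
    have h2 := (u' i).2
    change |((u i : ℕ) : ℤ) - (u' i : ℕ)| ≤ Q
    rw [abs_le]
    omega
  · set v : Fin n → ℤ := fun i => (u i : ℕ) - (u' i : ℕ) with hvdef
    have h1 : ∀ i, ‖(t i : ℚ_[p]) * v k - v i‖ ≤ (p : ℝ)⁻¹ ^ m := by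
      intro i
      by_cases hi : i = k
      · have : (t i : ℚ_[p]) = 1 := by rw [hi]; exact div_self hxk
        rw [this, hi, one_mul, sub_self, norm_zero]
        have := inv_prime_pos p
        positivity
      · have h2 : PadicInt.toZModPow m (t i * (v k : ℤ_[p]) - (v i : ℤ_[p])) = 0 := by
          have h3 := congrFun hf ⟨i, hi⟩
          simp only [f] at h3
          rw [← sub_eq_zero, ← map_sub] at h3
          rw [← h3]
          congr 1
          simp only [hvdef]
          push_cast
          ring
        rw [← RingHom.mem_ker, PadicInt.ker_toZModPow, ← PadicInt.norm_le_pow_iff_mem_span_pow,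
          PadicInt.norm_def] at h2
        simpa using h2
    intro i j
    have key : x i * v j - x j * v i
        = (x j * ((t i : ℚ_[p]) * v k - v i)) - (x i * ((t j : ℚ_[p]) * v k - v j)) := by
      rw [← htx i, ← htx j]; ring
    rw [key, mul_comm _ ‖x‖]
    refine padic_norm_sub_le ?_ ?_ <;> rw [norm_mul] <;>
      exact mul_le_mul (norm_le_pi_norm x _) (h1 _) (norm_nonneg _) (norm_nonneg _)

theorem exists_boundedPrim_near (hn : 2 ≤ n) {x : Fin n → ℚ_[p]} (hx : x ≠ 0) (s : ℕ) :
    ∃ a ≤ (n - 1) * s, ∃ w ∈ boundedPrim n (p ^ ((n - 1) * s - a)),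
      x ∈ padicCone p (n * s - a) (intPadic p w) := by
  have hp : p.Prime := Fact.out
  have hp0 : (0 : ℝ) < p := Nat.cast_pos.2 hp.pos
  obtain ⟨v, hv0, hvQ, hv⟩ := exists_int_vector_near (p := p) hx
    (m := n * s) (Q := p ^ ((n - 1) * s)) (by
      rw [← pow_mul, show n * s * (n - 1) = (n - 1) * s * n by ring, pow_mul]
      exact Nat.pow_lt_pow_left (Nat.lt_succ_self _) (by omega))
  obtain ⟨w, hw, hw1⟩ := Finset.extract_gcd (s := Finset.univ) v ⟨⟨0, by omega⟩, Finset.mem_univ _⟩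
  set g := Finset.univ.gcd v
  have hprim : IsPrim w := hw1
  have hvw : ∀ i, v i = g * w i := fun i => hw i (Finset.mem_univ i)
  have hg : g ≠ 0 := by
    rintro h
    exact hv0 (funext fun i => by simp [hvw, h])
  set a := padicValInt p g with ha
  have hgnorm : ‖(g : ℚ_[p])‖ = (p : ℝ)⁻¹ ^ a := by
    rw [Padic.norm_eq_zpow_neg_valuation (by exact_mod_cast hg), Padic.valuation_intCast]
    simp [ha]
  have hdvd : (p : ℤ) ^ a ∣ g := (padicValInt_dvd_iff a g).2 (Or.inr le_rfl)
  have hle : (p : ℤ) ^ a ≤ |g| := by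
    have := Int.le_of_dvd (abs_pos.2 hg) ((dvd_abs _ _).2 hdvd)
    exact this
  have hwQ : ∀ i, (p : ℤ) ^ a * |w i| ≤ (p : ℤ) ^ ((n - 1) * s) := fun i => by
    have h1 := hvQ i
    rw [hvw, abs_mul] at h1
    push_cast at h1
    exact (mul_le_mul_of_nonneg_right hle (abs_nonneg _)).trans h1
  have haQ : a ≤ (n - 1) * s := by
    obtain ⟨i, hi⟩ := Function.ne_iff.1 hprim.ne_zero
    have h1 : 1 ≤ |w i| := Int.one_le_abs hi
    have h2 : (p : ℤ) ^ a ≤ (p : ℤ) ^ ((n - 1) * s) :=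
      (le_mul_of_one_le_right (by positivity) h1).trans (hwQ i)
    exact (Nat.pow_le_pow_iff_right hp.one_lt).1 (by exact_mod_cast h2)
  refine ⟨a, haQ, w, mem_boundedPrim.2 ⟨fun i => ?_, hprim⟩, hx, fun i j => ?_⟩
  · have h1 := hwQ i
    rw [← Nat.add_sub_cancel' haQ, pow_add] at h1
    push_cast
    exact le_of_mul_le_mul_left h1 (pow_pos (by exact_mod_cast hp.pos) a)
  · have hans : a ≤ n * s := haQ.trans (Nat.mul_le_mul_right s (Nat.sub_le n 1))
    have h1 := hv i j
    have e : x i * (v j : ℚ_[p]) - x j * (v i : ℚ_[p])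
        = g * (x i * intPadic p w j - x j * intPadic p w i) := by
      rw [hvw i, hvw j]; simp only [intPadic]; push_cast; ring
    rw [e, norm_mul, hgnorm, ← Nat.add_sub_cancel' hans, pow_add, mul_assoc] at h1
    rw [hprim.norm_intPadic, mul_one]
    simpa using le_of_mul_le_mul_left h1 (pow_pos (inv_prime_pos p) a)

end Dirichlet

section Covering

variable {p : ℕ} [Fact p.Prime] {n : ℕ}

theorem measureReal_biUnion_boundedPrim_le (Q j : ℕ) :
    (padicUnitMeasure p n).real (⋃ v ∈ boundedPrim n Q, padicCone p j (intPadic p v))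
      ≤ 3 ^ n * (Q ⊔ 1 : ℕ) ^ n * ((p : ℝ)⁻¹ ^ j) ^ (n - 1) := by
  have hr := inv_prime_pos p
  calc _ ≤ ∑ v ∈ boundedPrim n Q, (padicUnitMeasure p n).real (padicCone p j (intPadic p v)) :=
        measureReal_biUnion_finset_le _ _
    _ ≤ ∑ v ∈ boundedPrim n Q, ((p : ℝ)⁻¹ ^ j) ^ (n - 1) := Finset.sum_le_sum fun v hv =>
        measureReal_padicCone_le (intPadic_ne_zero (mem_boundedPrim.1 hv).2.ne_zero) j
    _ = (boundedPrim n Q).card * ((p : ℝ)⁻¹ ^ j) ^ (n - 1) := by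
        rw [Finset.sum_const, nsmul_eq_mul]
    _ ≤ _ := by
        have h : (boundedPrim n Q).card ≤ 3 ^ n * (Q ⊔ 1) ^ n := by
          refine (card_boundedPrim_le n Q).trans ?_
          rw [← mul_pow]
          refine Nat.pow_le_pow_left ?_ n
          have := le_max_left Q 1
          have := le_max_right Q 1
          omega
        gcongr
        exact_mod_cast h

theorem sum_Ioc_pow_le {r : ℝ} (hr : 0 ≤ r) (hr' : r ≤ 1 / 2) (a b : ℕ) :
    ∑ i ∈ Finset.Ioc a b, r ^ i ≤ r ^ a := by
  rcases le_total b a with h | h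
  · rw [Finset.Ioc_eq_empty_of_le h, Finset.sum_empty]
    positivity
  · suffices ∑ i ∈ Finset.Ioc a b, r ^ i ≤ r ^ a - r ^ b from
      this.trans (sub_le_self _ (by positivity))
    induction b, h using Nat.le_induction with
    | base => simp
    | succ b hab ih =>
      rw [Finset.sum_Ioc_succ_top (by omega)]
      have : r ^ (b + 1) ≤ r ^ b * (1 / 2) := by
        rw [pow_succ]; gcongr
      linarith

/-- Points of height at most `p ^ ((n - 1) s)` come within `p ^ (A - n s)` of all points outside a
set of measure `O(p ^ (-A))`. -/
theorem one_sub_le_measureReal_biUnion_boundedPrim (hn : 2 ≤ n) (A s : ℕ) :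
    1 - 3 ^ n * (p : ℝ)⁻¹ ^ A ≤ (padicUnitMeasure p n).real
      (⋃ v ∈ boundedPrim n (p ^ ((n - 1) * s)), padicCone p (n * s - A) (intPadic p v)) := by
  have hp : p.Prime := Fact.out
  have hp0 : (0 : ℝ) < p := Nat.cast_pos.2 hp.pos
  have hr := inv_prime_pos p
  set G := ⋃ v ∈ boundedPrim n (p ^ ((n - 1) * s)), padicCone p (n * s - A) (intPadic p v)
  set W : ℕ → Set (Fin n → ℚ_[p]) := fun a =>
    ⋃ w ∈ boundedPrim n (p ^ ((n - 1) * s - a)), padicCone p (n * s - a) (intPadic p w)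
  have hcover : (Set.univ : Set (Fin n → ℚ_[p])) ⊆
      (G ∪ ⋃ a ∈ Finset.Ioc A ((n - 1) * s), W a) ∪
        {x | PadicNear p 0 x (fun _ : Fin n => (1 : ℚ_[p]))} := by
    intro x _
    by_cases hx : x = 0
    · right
      intro i j
      simp [hx]
    left
    obtain ⟨a, ha, w, hw, hxw⟩ := exists_boundedPrim_near hn hx s
    by_cases haA : a ≤ A
    · left
      exact Set.mem_biUnion (boundedPrim_mono (Nat.pow_le_pow_right hp.pos (Nat.sub_le _ _)) hw)
        (padicCone_anti (Nat.sub_le_sub_left haA _) hxw)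
    · right
      exact Set.mem_biUnion (Finset.mem_coe.2 (Finset.mem_Ioc.2 ⟨not_le.1 haA, ha⟩))
        (Set.mem_biUnion hw hxw)
  have h1 : (fun _ : Fin n => (1 : ℚ_[p])) ≠ 0 :=
    Function.ne_iff.2 ⟨⟨0, by omega⟩, one_ne_zero⟩
  have hnull : (padicUnitMeasure p n).real
      {x | PadicNear p 0 x (fun _ : Fin n => (1 : ℚ_[p]))} = 0 :=
    (measureReal_eq_zero_iff (measure_ne_top _ _)).2 (measure_padicNear_zero hn h1)
  have hW : ∀ a ∈ Finset.Ioc A ((n - 1) * s),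
      (padicUnitMeasure p n).real (W a) ≤ 3 ^ n * (p : ℝ)⁻¹ ^ a := by
    intro a ha
    have hale := (Finset.mem_Ioc.1 ha).2
    refine (measureReal_biUnion_boundedPrim_le _ _).trans ?_
    rw [max_eq_left (Nat.one_le_pow _ _ hp.pos), mul_assoc]
    gcongr
    obtain ⟨b, hb⟩ := Nat.exists_eq_add_of_le hale
    obtain ⟨d, rfl⟩ : ∃ d, n = d + 1 := ⟨n - 1, by omega⟩
    simp only [Nat.add_sub_cancel] at hb ⊢
    have e1 : d * s - a = b := by omega
    have e2 : (d + 1) * s - a = b + s := by rw [add_mul, one_mul]; omega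
    rw [e1, e2]
    have e3 : (b + s) * d = b * (d + 1) + a := by linear_combination hb
    push_cast
    rw [← pow_mul, ← pow_mul, e3, pow_add, ← mul_assoc, ← mul_pow, mul_inv_cancel₀ hp0.ne',
      one_pow, one_mul]
  have h2 := (measureReal_mono (μ := padicUnitMeasure p n) hcover).trans (measureReal_union_le _ _)
  have h3 := measureReal_union_le (μ := padicUnitMeasure p n) G
    (⋃ a ∈ Finset.Ioc A ((n - 1) * s), W a)
  have h4 := (measureReal_biUnion_finset_le (μ := padicUnitMeasure p n)
    (Finset.Ioc A ((n - 1) * s)) W).trans (Finset.sum_le_sum hW)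
  rw [← Finset.mul_sum] at h4
  have h5 := mul_le_mul_of_nonneg_left
    (sum_Ioc_pow_le hr.le (inv_prime_le_half p) A ((n - 1) * s)) (by positivity : (0 : ℝ) ≤ 3 ^ n)
  rw [probReal_univ, hnull] at h2
  linarith

/-- Shrinking the balls of a family covering most of the space, and discarding those that meet `U`,
adds to `U` a definite proportion of the mass still missing. -/
theorem measureReal_union_biUnion_ge {P : Finset (Fin n → ℤ)} (hP : ∀ v ∈ P, v ≠ 0) (h k : ℕ)
    {U T : Set (Fin n → ℚ_[p])}
    (hUT : ∀ v ∈ P, ∀ x ∈ padicCone p h (intPadic p v), x ∈ U →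
      padicCone p h (intPadic p v) ⊆ U ∪ T) :
    (padicUnitMeasure p n).real U + (padicHaar p n).real (Metric.ball 0 1) *
        ((p : ℝ)⁻¹ ^ k) ^ (n - 1) *
        ((padicUnitMeasure p n).real (⋃ v ∈ P, padicCone p h (intPadic p v))
          - (padicUnitMeasure p n).real T - (padicUnitMeasure p n).real U)
      ≤ (padicUnitMeasure p n).real (U ∪ ⋃ v ∈ P, padicCone p (h + k) (intPadic p v)) := by
  classical
  set μ := padicUnitMeasure p n
  have hr := inv_prime_pos p
  set C : ℕ → (Fin n → ℤ) → Set (Fin n → ℚ_[p]) := fun j v => padicCone p j (intPadic p v)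
  have hC : ∀ j v, MeasurableSet (C j v) := fun j v => measurableSet_padicCone
  set P' := P.filter fun v => Disjoint (C h v) U
  obtain ⟨R, hRP, hRim, hRinj⟩ : ∃ R : Finset (Fin n → ℤ), R ⊆ P' ∧
      (∀ v ∈ P', ∃ w ∈ R, C h w = C h v) ∧ Set.InjOn (C h) (R : Set (Fin n → ℤ)) := by
    obtain ⟨u, hus, hinj, hu⟩ := Set.SurjOn.exists_subset_injOn_image_eq
      (Set.surjOn_image (C h) (P' : Set (Fin n → ℤ)))
    have hfin : u.Finite := P'.finite_toSet.subset hus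
    refine ⟨hfin.toFinset, fun v hv => hus (hfin.mem_toFinset.1 hv), fun v hv => ?_, ?_⟩
    · have : C h v ∈ C h '' u := by rw [hu]; exact Set.mem_image_of_mem _ hv
      obtain ⟨w, hw, hwv⟩ := this
      exact ⟨w, hfin.mem_toFinset.2 hw, hwv⟩
    · rwa [hfin.coe_toFinset]
  have hRmem : ∀ v ∈ R, v ∈ P ∧ Disjoint (C h v) U := fun v hv => Finset.mem_filter.1 (hRP hv)
  have hne : ∀ v ∈ R, intPadic p v ≠ 0 := fun v hv => intPadic_ne_zero (hP v (hRmem v hv).1)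
  have hcover : (⋃ v ∈ P, C h v) ⊆ (U ∪ T) ∪ ⋃ v ∈ R, C h v := by
    refine Set.iUnion₂_subset fun v hv x hx => ?_
    by_cases hd : Disjoint (C h v) U
    · right
      obtain ⟨w, hw, hwv⟩ := hRim v (Finset.mem_filter.2 ⟨hv, hd⟩)
      exact Set.mem_biUnion hw (hwv ▸ hx)
    · left
      obtain ⟨y, hy, hyU⟩ := Set.not_disjoint_iff.1 hd
      exact hUT v hv y hy hyU hx
  have hdisj : (R : Set (Fin n → ℤ)).PairwiseDisjoint (C (h + k)) := by
    intro v hv w hw hvw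
    refine Set.disjoint_left.2 fun x hxv hxw => hvw (hRinj hv hw ?_)
    have h1 := padicCone_anti (Nat.le_add_right h k) hxv
    have h2 := padicCone_anti (Nat.le_add_right h k) hxw
    exact (padicCone_subset_of_mem (hne v hv) h2 h1).antisymm
      (padicCone_subset_of_mem (hne w hw) h1 h2)
  have hdU : Disjoint U (⋃ v ∈ R, C (h + k) v) := by
    refine Set.disjoint_iUnion₂_right.2 fun v hv => ?_
    exact ((hRmem v hv).2.mono_left (padicCone_anti (Nat.le_add_right h k))).symm
  have hup : μ.real (⋃ v ∈ R, C h v) ≤ R.card * ((p : ℝ)⁻¹ ^ h) ^ (n - 1) := by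
    rw [← nsmul_eq_mul, ← Finset.sum_const]
    exact (measureReal_biUnion_finset_le _ _).trans
      (Finset.sum_le_sum fun v hv => measureReal_padicCone_le (hne v hv) h)
  have hlow : R.card * ((padicHaar p n).real (Metric.ball 0 1) * ((p : ℝ)⁻¹ ^ (h + k)) ^ (n - 1))
      ≤ μ.real (⋃ v ∈ R, C (h + k) v) := by
    rw [measureReal_biUnion_finset hdisj fun v _ => hC _ v, ← nsmul_eq_mul, ← Finset.sum_const]
    exact Finset.sum_le_sum fun v hv => le_measureReal_padicCone (hne v hv) _
  have hmiss : μ.real (⋃ v ∈ P, C h v) - μ.real T - μ.real U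
      ≤ R.card * ((p : ℝ)⁻¹ ^ h) ^ (n - 1) := by
    have h1 := (measureReal_mono (μ := μ) hcover).trans (measureReal_union_le _ _)
    have h2 := measureReal_union_le (μ := μ) U T
    linarith
  calc _ ≤ μ.real U + (padicHaar p n).real (Metric.ball 0 1) *
        ((p : ℝ)⁻¹ ^ k) ^ (n - 1) * (R.card * ((p : ℝ)⁻¹ ^ h) ^ (n - 1)) := by gcongr
    _ = μ.real U + R.card * ((padicHaar p n).real (Metric.ball 0 1) *
        ((p : ℝ)⁻¹ ^ (h + k)) ^ (n - 1)) := by rw [pow_add, mul_pow]; ring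
    _ ≤ μ.real U + μ.real (⋃ v ∈ R, C (h + k) v) := by gcongr
    _ = μ.real (U ∪ ⋃ v ∈ R, C (h + k) v) :=
        (measureReal_union hdU (Finset.measurableSet_biUnion _ fun v _ => hC _ v)
          (measure_ne_top _ _) (measure_ne_top _ _)).symm
    _ ≤ _ := by
        refine measureReal_mono (Set.union_subset_union_right _ ?_)
        exact Set.biUnion_subset_biUnion_left fun v hv => (hRmem v hv).1

end Covering

theorem summable_of_summable_condensed {n B : ℕ} (hn : 1 ≤ n) (hB : 2 ≤ B) {ψ : ℕ → ℝ}
    (hψ : ∀ q, 0 ≤ ψ q) (hmono : Antitone ψ)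
    (h : Summable fun k : ℕ => ((B : ℝ) ^ k) ^ n * ψ (B ^ k) ^ (n - 1)) :
    Summable fun q : ℕ => (q : ℝ) ^ (n - 1) * ψ q ^ (n - 1) := by
  set f : ℕ → ℝ := fun q => (q : ℝ) ^ (n - 1) * ψ q ^ (n - 1)
  set g : ℕ → ℝ := fun k => ((B : ℝ) ^ k) ^ n * ψ (B ^ k) ^ (n - 1)
  have hf : ∀ q, 0 ≤ f q := fun q => mul_nonneg (by positivity) (pow_nonneg (hψ q) _)
  have hg : ∀ q, 0 ≤ g q := fun q => mul_nonneg (by positivity) (pow_nonneg (hψ _) _)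
  have hblock : ∀ K, ∑ q ∈ Finset.Ico (B ^ K) (B ^ (K + 1)), f q ≤ (B : ℝ) ^ n * g K := by
    intro K
    calc ∑ q ∈ Finset.Ico (B ^ K) (B ^ (K + 1)), f q
        ≤ ∑ q ∈ Finset.Ico (B ^ K) (B ^ (K + 1)),
          ((B : ℝ) ^ (K + 1)) ^ (n - 1) * ψ (B ^ K) ^ (n - 1) := by
          refine Finset.sum_le_sum fun q hq => ?_
          obtain ⟨h1, h2⟩ := Finset.mem_Ico.1 hq
          have h3 : (q : ℝ) ≤ (B : ℝ) ^ (K + 1) := by exact_mod_cast h2.le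
          have h4 := hψ q
          have h5 := hmono h1
          simp only [f]
          gcongr
      _ ≤ (B : ℝ) ^ (K + 1) * (((B : ℝ) ^ (K + 1)) ^ (n - 1) * ψ (B ^ K) ^ (n - 1)) := by
          rw [Finset.sum_const, nsmul_eq_mul, Nat.card_Ico]
          refine mul_le_mul_of_nonneg_right ?_ (mul_nonneg (by positivity) (pow_nonneg (hψ _) _))
          exact_mod_cast Nat.sub_le _ _
      _ = (B : ℝ) ^ n * g K := by
          obtain ⟨d, rfl⟩ : ∃ d, n = d + 1 := ⟨n - 1, by omega⟩
          simp only [g, Nat.add_sub_cancel]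
          ring
  have hsum : ∀ K, ∑ q ∈ Finset.range (B ^ K), f q
      ≤ f 0 + (B : ℝ) ^ n * ∑ k ∈ Finset.range K, g k := by
    intro K
    induction K with
    | zero => simp
    | succ K ih =>
      rw [← Finset.sum_range_add_sum_Ico f (Nat.pow_le_pow_right (by omega) (Nat.le_succ K)),
        Finset.sum_range_succ]
      have := hblock K
      rw [Nat.succ_eq_add_one]
      linarith
  refine summable_of_sum_range_le (c := f 0 + (B : ℝ) ^ n * ∑' k, g k) hf fun K => ?_
  calc ∑ q ∈ Finset.range K, f q ≤ ∑ q ∈ Finset.range (B ^ K), f q :=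
        Finset.sum_le_sum_of_subset_of_nonneg
          (Finset.range_subset_range.2 (Nat.lt_pow_self (by omega)).le) fun q _ _ => hf q
    _ ≤ _ := hsum K
    _ ≤ _ := by
        gcongr
        exact h.sum_le_tsum _ fun k _ => hg k

section LimsupSet

variable {p : ℕ} [Fact p.Prime] {n : ℕ} {ψ : ℕ → ℝ}

/-- The cone of points approximated to within `ψ` by a rational point, with an error of the form
`p ^ (-j)`, `j ≥ K`. -/
def approximableCone (p : ℕ) [Fact p.Prime] (n : ℕ) (ψ : ℕ → ℝ) (K : ℕ) : Set (Fin n → ℚ_[p]) :=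
  {x | ∃ j ≥ K, ∃ v : Fin n → ℤ, IsPrim v ∧ (p : ℝ)⁻¹ ^ j ≤ ψ (Hsup v) ∧
    x ∈ padicCone p j (intPadic p v)}

theorem measurableSet_approximableCone (K : ℕ) : MeasurableSet (approximableCone p n ψ K) := by
  have : approximableCone p n ψ K = ⋃ j : ℕ, ⋃ v : Fin n → ℤ, ⋃ _ : j ≥ K ∧ IsPrim v ∧
      (p : ℝ)⁻¹ ^ j ≤ ψ (Hsup v), padicCone p j (intPadic p v) := by
    ext x
    simp only [approximableCone, Set.mem_ofPred_eq, Set.mem_iUnion, exists_prop]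
    constructor
    · rintro ⟨j, hj, v, hv, hle, hx⟩
      exact ⟨j, v, ⟨hj, hv, hle⟩, hx⟩
    · rintro ⟨j, v, ⟨hj, hv, hle⟩, hx⟩
      exact ⟨j, hj, v, hv, hle, hx⟩
  rw [this]
  exact MeasurableSet.iUnion fun j => MeasurableSet.iUnion fun v => MeasurableSet.iUnion fun _ =>
    measurableSet_padicCone

theorem exists_pow_le_of_pos (p : ℕ) [Fact p.Prime] {c : ℝ} (hc : 0 < c) (h : ℕ) :
    ∃ k : ℕ, (p : ℝ)⁻¹ ^ (h + k) ≤ c ∧ (k = 0 ∨ (p : ℝ)⁻¹ * c ≤ (p : ℝ)⁻¹ ^ (h + k)) := by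
  classical
  have hr := inv_prime_pos p
  have hex : ∃ k : ℕ, (p : ℝ)⁻¹ ^ (h + k) ≤ c := by
    obtain ⟨k, hk⟩ := exists_pow_lt_of_lt_one hc (inv_prime_lt_one p)
    exact ⟨k, (pow_le_pow_of_le_one hr.le (inv_prime_lt_one p).le (by omega)).trans hk.le⟩
  refine ⟨Nat.find hex, Nat.find_spec hex, ?_⟩
  rcases hk : Nat.find hex with _ | k
  · exact Or.inl rfl
  · right
    have hmin := Nat.find_min hex (m := k) (by omega)
    rw [← add_assoc, pow_succ']
    exact mul_le_mul_of_nonneg_left (not_le.1 hmin).le hr.le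

theorem pos_of_not_summable (hn : 2 ≤ n) (hψ : ∀ q, 0 ≤ ψ q) (hmono : Antitone ψ)
    (hdiv : ¬ Summable fun q : ℕ => (q : ℝ) ^ (n - 1) * ψ q ^ (n - 1)) (q : ℕ) : 0 < ψ q := by
  by_contra! hq
  refine hdiv (summable_of_ne_finset_zero (s := Finset.range q) fun b hb => ?_)
  have hb' : q ≤ b := by simpa using hb
  have : ψ b = 0 := le_antisymm ((hmono hb').trans hq) (hψ b)
  rw [this, zero_pow (by omega), mul_zero]

theorem sum_range_mul_pow_le {D : ℝ} (hD : 1 < D) (l : ℕ) :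
    ∑ k ∈ Finset.range l, D ^ k ≤ D ^ l / (D - 1) := by
  rw [geom_sum_eq hD.ne']
  have : 0 < D - 1 := by linarith
  gcongr
  linarith

theorem measureReal_ball_pos : 0 < (padicHaar p n).real (Metric.ball 0 1) := by
  refine ENNReal.toReal_pos (Metric.isOpen_ball.measure_pos _ ⟨0, by simp⟩).ne' ?_
  refine ((measure_mono fun x hx => ?_).trans_lt
    ((padicHaar_unit (p := p) (n := n)).trans_lt ENNReal.one_lt_top)).ne
  exact fun i => (norm_le_pi_norm x i).trans (mem_ball_zero_iff.1 hx).le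

theorem one_sub_le_measureReal_approximableCone (hn : 2 ≤ n) (hψ : ∀ q, 0 ≤ ψ q)
    (hmono : Antitone ψ)
    (hdiv : ¬ Summable fun q : ℕ => (q : ℝ) ^ (n - 1) * ψ q ^ (n - 1)) (K : ℕ) {ε : ℝ}
    (hε : 0 < ε) : 1 - ε ≤ (padicUnitMeasure p n).real (approximableCone p n ψ K) := by
  by_contra! hlt
  have hp : p.Prime := Fact.out
  have hp1 : (1 : ℝ) < p := by exact_mod_cast hp.one_lt
  have hp0 : (0 : ℝ) < p := by linarith
  have hr := inv_prime_pos p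
  set μ := padicUnitMeasure p n
  set d := n - 1 with hd
  have hd1 : 1 ≤ d := by omega
  have hnd : n = d + 1 := by omega
  set c₀ := (padicHaar p n).real (Metric.ball 0 1)
  have hc₀ : 0 < c₀ := measureReal_ball_pos
  obtain ⟨A, hA⟩ : ∃ A : ℕ, 3 ^ n * (p : ℝ)⁻¹ ^ A ≤ ε / 3 := by
    obtain ⟨A, hA⟩ := exists_pow_lt_of_lt_one (show 0 < ε / 3 / 3 ^ n by positivity)
      (inv_prime_lt_one p)
    exact ⟨A, by rw [mul_comm, ← le_div_iff₀ (by positivity)]; exact hA.le⟩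
  obtain ⟨N, hNA, hN⟩ : ∃ N : ℕ, A + 1 ≤ N ∧
      3 ^ n * (p : ℝ) ^ (A * d) / (ε / 3) + 1 ≤ (p : ℝ) ^ (n * d * N) := by
    obtain ⟨N, hN⟩ := pow_unbounded_of_one_lt
      (3 ^ n * (p : ℝ) ^ (A * d) / (ε / 3) + 1) hp1
    refine ⟨N + (A + 1), by omega, hN.le.trans (pow_le_pow_right₀ hp1.le ?_)⟩
    have : 1 ≤ n * d := Nat.one_le_iff_ne_zero.2 (by positivity)
    nlinarith
  set D : ℝ := (p : ℝ) ^ (n * d * N) with hD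
  have hD1 : 0 < D - 1 := by
    have : 0 < 3 ^ n * (p : ℝ) ^ (A * d) / (ε / 3) := by positivity
    linarith
  let s : ℕ → ℕ := fun l => N * (l + K + 1)
  let Q : ℕ → ℕ := fun l => p ^ (d * s l)
  let h : ℕ → ℕ := fun l => n * s l - A
  have hAs : ∀ l, A + K ≤ n * s l := fun l => by
    have h1 : (A + 1) * (K + 1) ≤ N * (l + K + 1) := Nat.mul_le_mul hNA (by omega)
    have h2 : N * (l + K + 1) ≤ n * (N * (l + K + 1)) := Nat.le_mul_of_pos_left _ (by omega)
    have h3 : A + K ≤ (A + 1) * (K + 1) := by nlinarith [Nat.zero_le (A * K)]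
    exact (h3.trans h1).trans h2
  have hQD : ∀ l, (Q l : ℝ) ^ n = D ^ (l + K + 1) := fun l => by
    simp only [Q, s, hD]
    push_cast
    rw [← pow_mul, ← pow_mul]
    congr 1
    ring
  have hhD : ∀ l, ((p : ℝ) ^ (h l)) ^ d * (p : ℝ) ^ (A * d) = D ^ (l + K + 1) := fun l => by
    have e : h l + A = n * s l := Nat.sub_add_cancel ((Nat.le_add_right A K).trans (hAs l))
    rw [pow_mul, ← mul_pow, ← pow_add, e, hD, ← pow_mul, ← pow_mul]
    congr 1
    simp only [s]
    ring
  choose κ hκ hκ' using fun l =>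
    exists_pow_le_of_pos p (pos_of_not_summable hn hψ hmono hdiv (Q l)) (h l)
  let E : ℕ → Set (Fin n → ℚ_[p]) := fun l =>
    ⋃ v ∈ boundedPrim n (Q l), padicCone p (h l + κ l) (intPadic p v)
  let U : ℕ → Set (Fin n → ℚ_[p]) := fun l => ⋃ k ∈ Finset.range l, E k
  have hEF : ∀ l, E l ⊆ approximableCone p n ψ K := fun l =>
    Set.iUnion₂_subset fun v hv x hx =>
      ⟨h l + κ l, (Nat.le_sub_of_add_le' (hAs l)).trans (Nat.le_add_right _ _), v,
        (mem_boundedPrim.1 hv).2, (hκ l).trans (hmono (Hsup_le_of_mem_boundedPrim hv)), hx⟩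
  have hUF : ∀ l, μ.real (U l) < 1 - ε := fun l =>
    (measureReal_mono (Set.iUnion₂_subset fun k _ => hEF k)).trans_lt hlt
  have hUsucc : ∀ l, U (l + 1) = U l ∪ E l := fun l => by
    simp only [U, Finset.range_add_one, Finset.set_biUnion_insert]
    exact Set.union_comm _ _
  let T : ℕ → Set (Fin n → ℚ_[p]) := fun l =>
    ⋃ k ∈ Finset.range l, ⋃ w ∈ boundedPrim n (Q k), padicCone p (h l) (intPadic p w)
  have hT : ∀ l, μ.real (T l) ≤ ε / 3 := fun l => by
    have h1 : ∀ k ∈ Finset.range l,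
        μ.real (⋃ w ∈ boundedPrim n (Q k), padicCone p (h l) (intPadic p w))
          ≤ 3 ^ n * D ^ (K + 1) * (((p : ℝ)⁻¹ ^ (h l)) ^ d) * D ^ k := fun k _ => by
      refine (measureReal_biUnion_boundedPrim_le _ _).trans_eq ?_
      rw [max_eq_left (Nat.one_le_pow _ _ hp.pos), hQD]
      ring
    have h2 : ((p : ℝ)⁻¹ ^ (h l)) ^ d * D ^ (l + K + 1) = (p : ℝ) ^ (A * d) := by
      rw [← hhD, ← mul_assoc, ← mul_pow, ← mul_pow, inv_mul_cancel₀ hp0.ne', one_pow, one_pow,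
        one_mul]
    calc μ.real (T l) ≤ _ := measureReal_biUnion_finset_le _ _
      _ ≤ _ := Finset.sum_le_sum h1
      _ = 3 ^ n * D ^ (K + 1) * (((p : ℝ)⁻¹ ^ (h l)) ^ d) * ∑ k ∈ Finset.range l, D ^ k := by
        rw [Finset.mul_sum]
      _ ≤ 3 ^ n * D ^ (K + 1) * (((p : ℝ)⁻¹ ^ (h l)) ^ d) * (D ^ l / (D - 1)) := by
        have : 0 < D := by linarith
        gcongr
        exact sum_range_mul_pow_le (by linarith) l
      _ = 3 ^ n * (((p : ℝ)⁻¹ ^ (h l)) ^ d * D ^ (l + K + 1)) / (D - 1) := by ring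
      _ ≤ ε / 3 := by
        rw [h2, div_le_iff₀ hD1, mul_comm (ε / 3), ← div_le_iff₀ (by positivity)]
        linarith
  have hstep : ∀ l, μ.real (U l) + c₀ * ((p : ℝ)⁻¹ ^ κ l) ^ d * (ε / 3) ≤ μ.real (U (l + 1)) := by
    intro l
    have h1 := measureReal_union_biUnion_ge (p := p)
      (fun v hv => (mem_boundedPrim.1 hv).2.ne_zero : ∀ v ∈ boundedPrim n (Q l), v ≠ 0)
      (h l) (κ l) (U := U l) (T := T l) ?_
    · rw [← hUsucc] at h1
      refine le_trans ?_ h1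
      gcongr
      have h2 := one_sub_le_measureReal_biUnion_boundedPrim (p := p) hn A (s l)
      have h3 := hT l
      have h4 := hUF l
      linarith
    · intro v hv x hxv hxU
      have hv0 : intPadic p v ≠ 0 := intPadic_ne_zero (mem_boundedPrim.1 hv).2.ne_zero
      simp only [U, E, Set.mem_iUnion] at hxU
      obtain ⟨k, hk, w, hw, hxw⟩ := hxU
      rcases le_total (h k + κ k) (h l) with hle | hle
      · refine Set.subset_union_of_subset_left ?_ _
        exact fun y hy => Set.mem_biUnion hk (Set.mem_biUnion hw
            ⟨hy.1, ((padicCone_anti hle hy).2.trans hv0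
              ((padicCone_anti hle hxv).2.symm.trans hxv.1 hxw.2))⟩)
      · refine Set.subset_union_of_subset_right ?_ _
        exact fun y hy => Set.mem_biUnion hk (Set.mem_biUnion hw
          (padicCone_subset_of_mem hv0 (padicCone_anti hle hxw) hxv hy))
  have hsum : Summable fun l => ((p : ℝ)⁻¹ ^ κ l) ^ d := by
    refine summable_of_sum_range_le (c := 1 / (c₀ * (ε / 3))) (fun l => by positivity) fun L => ?_
    rw [le_div_iff₀ (by positivity)]
    have h1 : ∀ L, (∑ l ∈ Finset.range L, ((p : ℝ)⁻¹ ^ κ l) ^ d) * (c₀ * (ε / 3))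
        ≤ μ.real (U L) := by
      intro L
      induction L with
      | zero => simp
      | succ L ih =>
        rw [Finset.sum_range_succ, add_mul]
        have := hstep L
        linarith
    exact (h1 L).trans (by have := hUF L; linarith)
  have hev : ∀ᶠ l in Filter.atTop, D ^ (l + K + 1) * ψ (Q l) ^ d
      ≤ (p : ℝ) ^ d * (p : ℝ) ^ (A * d) * ((p : ℝ)⁻¹ ^ κ l) ^ d := by
    filter_upwards [hsum.tendsto_atTop_zero.eventually (gt_mem_nhds one_pos)] with l hl
    have hκ0 : κ l ≠ 0 := fun h0 => by simp [h0] at hl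
    have h1 := (hκ' l).resolve_left hκ0
    have h2 : (p : ℝ) ^ (h l) * ψ (Q l) ≤ p * (p : ℝ)⁻¹ ^ κ l := by
      have h3 : ψ (Q l) ≤ p * (p : ℝ)⁻¹ ^ (h l + κ l) := by
        rwa [inv_mul_le_iff₀ hp0] at h1
      calc (p : ℝ) ^ (h l) * ψ (Q l)
          ≤ (p : ℝ) ^ (h l) * (p * (p : ℝ)⁻¹ ^ (h l + κ l)) := by gcongr
        _ = ((p : ℝ) * (p : ℝ)⁻¹) ^ (h l) * (p * (p : ℝ)⁻¹ ^ κ l) := by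
          rw [pow_add, mul_pow]; ring
        _ = _ := by rw [mul_inv_cancel₀ hp0.ne', one_pow, one_mul]
    have h4 := pow_le_pow_left₀ (mul_nonneg (by positivity) (hψ _)) h2 d
    rw [mul_pow, mul_pow] at h4
    rw [← hhD]
    calc _ = (p : ℝ) ^ (A * d) * (((p : ℝ) ^ h l) ^ d * ψ (Q l) ^ d) := by ring
      _ ≤ (p : ℝ) ^ (A * d) * ((p : ℝ) ^ d * ((p : ℝ)⁻¹ ^ κ l) ^ d) := by gcongr
      _ = _ := by ring
  have hsum' : Summable fun l => D ^ (l + K + 1) * ψ (Q l) ^ d := by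
    refine Summable.of_norm_bounded_eventually_nat
      (hsum.mul_left ((p : ℝ) ^ d * (p : ℝ) ^ (A * d))) ?_
    filter_upwards [hev] with l hl
    rwa [Real.norm_of_nonneg]
    exact mul_nonneg (pow_nonneg (by linarith) _) (pow_nonneg (hψ _) _)
  refine hdiv (summable_of_summable_condensed (B := p ^ (d * N)) (by omega) ?_ hψ hmono ?_)
  · exact hp.two_le.trans (Nat.le_self_pow (Nat.mul_ne_zero (by omega) (by omega)) p)
  · rw [← summable_nat_add_iff (K + 1)]
    refine hsum'.congr fun l => ?_
    have e : (p ^ (d * N)) ^ (l + (K + 1)) = Q l := by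
      simp only [Q, s]
      rw [← pow_mul]
      congr 1
      ring
    rw [← hQD, ← e]
    push_cast
    rfl

theorem ae_mem_approximableCone (hn : 2 ≤ n) (hψ : ∀ q, 0 ≤ ψ q) (hmono : Antitone ψ)
    (hdiv : ¬ Summable fun q : ℕ => (q : ℝ) ^ (n - 1) * ψ q ^ (n - 1)) :
    ∀ᵐ x ∂(padicUnitMeasure p n), ∀ K, x ∈ approximableCone p n ψ K := by
  refine ae_all_iff.2 fun K => ?_
  have h1 : (padicUnitMeasure p n).real (approximableCone p n ψ K) = 1 :=
    le_antisymm measureReal_le_one (le_of_forall_pos_sub_le fun ε hε =>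
      one_sub_le_measureReal_approximableCone hn hψ hmono hdiv K hε)
  have h2 : padicUnitMeasure p n (approximableCone p n ψ K) = 1 := by
    rwa [measureReal_def, ENNReal.toReal_eq_one_iff] at h1
  exact (mem_ae_iff_prob_eq_one (measurableSet_approximableCone K)).2 h2

/-- Integer vectors spanning the same rational line are close to the same `p`-adic points. -/
theorem PadicNear.of_mk_eq {r : ℝ} {x : Fin n → ℚ_[p]} {v w : Fin n → ℤ} (hv : intRat v ≠ 0)
    (hw : intRat w ≠ 0)
    (h : Projectivization.mk ℚ (intRat w) hw = Projectivization.mk ℚ (intRat v) hv)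
    (hx : PadicNear p r x (intPadic p v)) : PadicNear p r x (intPadic p w) := by
  obtain ⟨a, ha⟩ := (Projectivization.mk_eq_mk_iff' ℚ _ _ hw hv).1 h
  have e : ((a : ℚ) : ℚ_[p]) • intPadic p v = intPadic p w := by
    funext i
    have := congrFun ha i
    simp only [Pi.smul_apply, intRat, smul_eq_mul] at this
    simp only [Pi.smul_apply, intPadic, smul_eq_mul]
    exact_mod_cast congrArg (fun q : ℚ => (q : ℚ_[p])) this
  rw [← e]
  exact hx.smul_right _

theorem mk_mem_Wp {x : Fin n → ℚ_[p]} (hx : x ≠ 0) (h : ∀ K, x ∈ approximableCone p n ψ K)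
    (hirr : ∀ v : Fin n → ℤ, v ≠ 0 → ¬ PadicNear p 0 x (intPadic p v)) :
    Projectivization.mk ℚ_[p] x hx ∈ Wp p n ψ := by
  have hr := inv_prime_pos p
  choose j hj v hv hψv hxv using h
  have hv0 : ∀ K, intRat (v K) ≠ 0 := fun K => intRat_ne_zero (hv K).ne_zero
  obtain ⟨a, ha⟩ := Projectivization.exists_smul_eq_mk_rep ℚ_[p] x hx
  have hmem : ∀ K, Projectivization.mk ℚ (intRat (v K)) (hv0 K) ∈
      {y : Projectivization ℚ (Fin n → ℚ) | ∃ v : Fin n → ℤ, IsPrim v ∧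
      (∃ hv : intRat v ≠ 0, y = Projectivization.mk ℚ (intRat v) hv) ∧
      padicDelta p (Projectivization.mk ℚ_[p] x hx).rep (intPadic p v) ≤ ψ (Hsup v)} := by
    intro K
    refine ⟨v K, hv K, ⟨hv0 K, rfl⟩, ?_⟩
    rw [← ha]
    exact (((hxv K).2.smul_left (a : ℚ_[p])).padicDelta_le (by positivity)).trans (hψv K)
  intro hfin
  have : Finite ↥{y : Projectivization ℚ (Fin n → ℚ) | ∃ v : Fin n → ℤ, IsPrim v ∧
      (∃ hv : intRat v ≠ 0, y = Projectivization.mk ℚ (intRat v) hv) ∧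
      padicDelta p (Projectivization.mk ℚ_[p] x hx).rep (intPadic p v) ≤ ψ (Hsup v)} := hfin
  obtain ⟨y, hy⟩ := Finite.exists_infinite_fiber fun K => Subtype.mk _ (hmem K)
  rw [Set.infinite_coe_iff] at hy
  obtain ⟨K₀, hK₀⟩ := hy.nonempty
  have hnear : ∀ m : ℕ, PadicNear p ((p : ℝ)⁻¹ ^ m) x (intPadic p (v K₀)) := fun m => by
    obtain ⟨K, hK, hmK⟩ := hy.exists_gt m
    have e := congrArg Subtype.val (Eq.trans hK₀ (Eq.symm hK))
    refine PadicNear.of_mk_eq (hv0 K) (hv0 K₀) e ((hxv K).2.mono ?_)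
    exact pow_le_pow_of_le_one hr.le (inv_prime_lt_one p).le (hmK.le.trans (hj K))
  refine hirr (v K₀) (hv K₀).ne_zero fun a b => ?_
  exact ge_of_tendsto' ((tendsto_pow_atTop_nhds_zero_of_lt_one hr.le
    (inv_prime_lt_one p)).mul_const _) fun m => hnear m a b

end LimsupSet

/-- the projective Khintchine theorem at a finite place: for decreasing `ψ`,
divergence of `Σ q^{n-1} ψ(q)^{n-1}` implies full measure. -/
theorem projective_khintchine_padic (n p : ℕ) (hn : 2 ≤ n) [Fact p.Prime]
    (ψ : ℕ → ℝ) (hψ : ∀ q, 0 ≤ ψ q) (hmono : Antitone ψ)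
    (hdiv : ¬ Summable fun q : ℕ => (q : ℝ) ^ (n - 1) * ψ q ^ (n - 1)) :
    muP p n (Wp p n ψ) = 1 := by
  have hT : ∀ᵐ x ∂(padicUnitMeasure p n),
      ∃ hx : x ≠ 0, Projectivization.mk ℚ_[p] x hx ∈ Wp p n ψ := by
    have hirr : ∀ᵐ x ∂(padicUnitMeasure p n), ∀ v : Fin n → ℤ, v ≠ 0 →
        ¬ PadicNear p 0 x (intPadic p v) := by
      refine ae_all_iff.2 fun v => ?_
      by_cases hv : v = 0
      · simp [hv]
      · filter_upwards [measure_eq_zero_iff_ae_notMem.1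
          (measure_padicNear_zero (p := p) hn (intPadic_ne_zero hv))] with x hx _ using hx
    filter_upwards [ae_mem_approximableCone hn hψ hmono hdiv, hirr] with x hx hxv
    obtain ⟨j, -, v, hv, -, hj⟩ := hx 0
    have hx0 : x ≠ 0 := by
      rintro rfl
      exact hxv v hv.ne_zero fun a b => by simp
    exact ⟨hx0, mk_mem_Wp hx0 hx hxv⟩
  have h1 : padicUnitMeasure p n
      {x | ∃ hx : x ≠ 0, Projectivization.mk ℚ_[p] x hx ∈ Wp p n ψ} = 1 := by
    rw [measure_congr (Filter.eventuallyEq_univ.2 hT), measure_univ]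
  rw [padicUnitMeasure, Measure.restrict_apply' measurableSet_padicUnit, Set.inter_comm] at h1
  exact h1
end

section
/- Let n ≥ 2 and let ψ : ℕ → [0,∞) be a decreasing (monotone nonincreasing) function. If the series Σ_{q=1}^∞ q^{n-1} ψ(q)^{n-1} diverges, then μ_∞(W_∞(ψ, ℚ, n)) = 1, where W_∞(ψ, ℚ, n) is the set of x ∈ ℙ^{n-1}(ℝ) such that δ_∞(x, y) ≤ ψ(H(y)) for infinitely many distinct points y ∈ ℙ^{n-1}(ℚ). -/
open MeasureTheory

/-- A second-moment lower bound for the measure of a finite union. -/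
lemma measureReal_biUnion_ge_second_moment {α ι : Type*} [MeasurableSpace α] (μ : Measure α)
    (T : Finset ι) (A : ι → Set α) (hA : ∀ i, MeasurableSet (A i)) (hfin : ∀ i, μ (A i) ≠ ⊤)
    (t : ℝ) :
    2 * t * ∑ i ∈ T, μ.real (A i) - t ^ 2 * ∑ i ∈ T, ∑ j ∈ T, μ.real (A i ∩ A j) ≤
      μ.real (⋃ i ∈ T, A i) := by
  have hint : ∀ s : Set α, MeasurableSet s → μ s ≠ ⊤ → Integrable (s.indicator (1 : α → ℝ)) μ :=
    fun s hs hs' => (integrable_indicator_iff hs).2 (integrableOn_const hs')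
  have hU : MeasurableSet (⋃ i ∈ T, A i) := T.measurableSet_biUnion fun i _ => hA i
  have hUfin : μ (⋃ i ∈ T, A i) ≠ ⊤ :=
    (measure_biUnion_lt_top T.finite_toSet fun i _ => (hfin i).lt_top).ne
  have hI : ∀ i j, μ (A i ∩ A j) ≠ ⊤ := fun i j =>
    measure_ne_top_of_subset Set.inter_subset_left (hfin i)
  have h1 : Integrable (fun x => ∑ i ∈ T, (A i).indicator (1 : α → ℝ) x) μ :=
    integrable_finsetSum _ fun i _ => hint _ (hA i) (hfin i)
  have h2 : Integrable (fun x => ∑ i ∈ T, ∑ j ∈ T, (A i ∩ A j).indicator (1 : α → ℝ) x) μ :=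
    integrable_finsetSum _ fun i _ => integrable_finsetSum _ fun j _ =>
      hint _ ((hA i).inter (hA j)) (hI i j)
  have key : ∫ x, (2 * t * (∑ i ∈ T, (A i).indicator (1 : α → ℝ) x) -
      t ^ 2 * ∑ i ∈ T, ∑ j ∈ T, (A i ∩ A j).indicator (1 : α → ℝ) x) ∂μ ≤
      ∫ x, (⋃ i ∈ T, A i).indicator (1 : α → ℝ) x ∂μ := by
    refine integral_mono ((h1.const_mul _).sub (h2.const_mul _)) (hint _ hU hUfin) fun x => ?_
    have h3 : ∑ i ∈ T, ∑ j ∈ T, (A i ∩ A j).indicator (1 : α → ℝ) x =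
        (∑ i ∈ T, (A i).indicator (1 : α → ℝ) x) ^ 2 := by
      rw [sq, Finset.sum_mul_sum]
      simp [Set.inter_indicator_one]
    simp only [h3]
    by_cases hx : x ∈ ⋃ i ∈ T, A i
    · rw [Set.indicator_of_mem hx]
      simp only [Pi.one_apply]
      nlinarith [sq_nonneg (1 - t * ∑ i ∈ T, (A i).indicator (1 : α → ℝ) x)]
    · rw [Set.indicator_of_notMem hx]
      have : ∑ i ∈ T, (A i).indicator (1 : α → ℝ) x = 0 :=
        Finset.sum_eq_zero fun i hi =>
          Set.indicator_of_notMem (fun h => hx (Set.mem_biUnion hi h)) _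
      simp [this]
  have e1 : ∫ x, ∑ i ∈ T, (A i).indicator (1 : α → ℝ) x ∂μ = ∑ i ∈ T, μ.real (A i) := by
    rw [integral_finsetSum _ fun i _ => hint _ (hA i) (hfin i)]
    simp only [integral_indicator_one (hA _)]
  have e2 : ∫ x, ∑ i ∈ T, ∑ j ∈ T, (A i ∩ A j).indicator (1 : α → ℝ) x ∂μ =
      ∑ i ∈ T, ∑ j ∈ T, μ.real (A i ∩ A j) := by
    rw [integral_finsetSum _ fun i _ => integrable_finsetSum _ fun j _ =>
      hint _ ((hA i).inter (hA j)) (hI i j)]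
    refine Finset.sum_congr rfl fun i _ => ?_
    rw [integral_finsetSum _ fun j _ => hint _ ((hA i).inter (hA j)) (hI i j)]
    simp only [integral_indicator_one ((hA _).inter (hA _))]
  rwa [integral_sub (h1.const_mul _) (h2.const_mul _), integral_const_mul, integral_const_mul,
    integral_indicator_one hU, e1, e2] at key

/-- Simultaneous Dirichlet approximation. -/
lemma exists_simultaneous_approx {m M : ℕ} (hM : 0 < M) (ξ : Fin m → ℝ) :
    ∃ q : ℕ, 1 ≤ q ∧ q ≤ M ^ m ∧ ∃ p : Fin m → ℤ, ∀ i, |q * ξ i - p i| ≤ 1 / M := by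
  have hM' : (0 : ℝ) < M := by exact_mod_cast hM
  have hlt : ∀ y : ℝ, ⌊M * Int.fract y⌋₊ < M := fun y => by
    rw [Nat.floor_lt (by positivity)]
    nlinarith [Int.fract_lt_one y]
  let f : ℕ → Fin m → Fin M := fun q i => ⟨⌊M * Int.fract (q * ξ i)⌋₊, hlt _⟩
  have main : ∀ a b : ℕ, a < b → f a = f b →
      ∀ i, |((b - a : ℕ) : ℝ) * ξ i - ((⌊b * ξ i⌋ - ⌊a * ξ i⌋ : ℤ) : ℝ)| ≤ 1 / M := by
    intro a b hab h i
    have h1 : ⌊M * Int.fract (a * ξ i)⌋₊ = ⌊M * Int.fract (b * ξ i)⌋₊ := by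
      simpa [f] using congrFun h i
    have ha := Nat.floor_le (show 0 ≤ M * Int.fract (a * ξ i) by positivity)
    have ha' := Nat.lt_floor_add_one (M * Int.fract (a * ξ i))
    have hb := Nat.floor_le (show 0 ≤ M * Int.fract (b * ξ i) by positivity)
    have hb' := Nat.lt_floor_add_one (M * Int.fract (b * ξ i))
    rw [h1] at ha ha'
    have e : ((b - a : ℕ) : ℝ) * ξ i - ((⌊b * ξ i⌋ - ⌊a * ξ i⌋ : ℤ) : ℝ) =
        Int.fract (b * ξ i) - Int.fract (a * ξ i) := by
      rw [Nat.cast_sub hab.le]; push_cast; simp only [Int.fract]; ring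
    rw [e, abs_le, neg_le, le_div_iff₀ hM', le_div_iff₀ hM']
    constructor <;> nlinarith
  obtain ⟨a, ha, b, hb, hne, hab⟩ := Finset.exists_ne_map_eq_of_card_lt_of_maps_to
    (s := Finset.range (M ^ m + 1)) (t := (Finset.univ : Finset (Fin m → Fin M)))
    (by simp) (f := f) (fun _ _ => by simp)
  simp only [Finset.mem_range] at ha hb
  rcases lt_or_gt_of_ne hne with h | h
  · exact ⟨b - a, by omega, by omega, _, main a b h hab⟩
  · exact ⟨a - b, by omega, by omega, _, main b a h hab.symm⟩

lemma measureReal_pi_closedBall {m : ℕ} (x : Fin m → ℝ) {r : ℝ} (hr : 0 ≤ r) :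
    volume.real (Metric.closedBall x r) = (2 * r) ^ m := by
  rw [measureReal_def, Real.volume_pi_closedBall x hr, Fintype.card_fin,
    ENNReal.toReal_ofReal (by positivity)]

/-- Packing bound for separated sets in the sup norm. -/
lemma card_mul_pow_le_of_separated {m : ℕ} {ρ R : ℝ} (hρ : 0 < ρ) (hR : 0 ≤ R) (y : Fin m → ℝ)
    (S : Finset (Fin m → ℝ)) (hS : ∀ z ∈ S, dist z y ≤ R)
    (hsep : (S : Set (Fin m → ℝ)).Pairwise fun a b => ρ ≤ dist a b) :
    (S.card : ℝ) * ρ ^ m ≤ (2 * R + ρ) ^ m := by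
  have hball : ∀ z : Fin m → ℝ, volume.real (Metric.ball z (ρ / 2)) = ρ ^ m := fun z => by
    rw [measureReal_def, Real.volume_pi_ball z (by positivity), Fintype.card_fin,
      ENNReal.toReal_ofReal (by positivity)]
    ring
  have hdisj : (S : Set (Fin m → ℝ)).PairwiseDisjoint fun z => Metric.ball z (ρ / 2) :=
    fun a ha b hb hab => Metric.ball_disjoint_ball (by linarith [hsep ha hb hab])
  have h1 : volume.real (⋃ z ∈ S, Metric.ball z (ρ / 2)) = S.card * ρ ^ m := by
    rw [measureReal_biUnion_finset hdisj (fun _ _ => measurableSet_ball)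
      (fun _ _ => measure_ball_lt_top.ne)]
    simp [hball]
  have h2 : (⋃ z ∈ S, Metric.ball z (ρ / 2)) ⊆ Metric.closedBall y (R + ρ / 2) := by
    refine Set.iUnion₂_subset fun z hz w hw => ?_
    rw [Metric.mem_ball] at hw
    rw [Metric.mem_closedBall]
    linarith [dist_triangle w z y, hS z hz]
  rw [← h1]
  calc _ ≤ volume.real (Metric.closedBall y (R + ρ / 2)) :=
        measureReal_mono h2 measure_closedBall_lt_top.ne
    _ = _ := by rw [measureReal_pi_closedBall y (by positivity)]; ring

/-- Bounded sets have finite maximal separated nets. -/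
lemma exists_finset_separated_cover {m : ℕ} {ρ R : ℝ} (hρ : 0 < ρ) (hR : 0 ≤ R) (y : Fin m → ℝ)
    (P : Set (Fin m → ℝ)) (hP : P ⊆ Metric.closedBall y R) :
    ∃ S : Finset (Fin m → ℝ), (S : Set (Fin m → ℝ)) ⊆ P ∧
      (S : Set (Fin m → ℝ)).Pairwise (fun a b => ρ ≤ dist a b) ∧
      ∀ z ∈ P, ∃ s ∈ S, dist z s ≤ ρ := by
  classical
  let C : Set ℕ := {N | ∃ S : Finset (Fin m → ℝ), (S : Set (Fin m → ℝ)) ⊆ P ∧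
      (S : Set (Fin m → ℝ)).Pairwise (fun a b => ρ ≤ dist a b) ∧ S.card = N}
  have hne : C.Nonempty := ⟨0, ∅, by simp, by simp, rfl⟩
  have hbdd : BddAbove C := by
    refine ⟨⌊(2 * R + ρ) ^ m / ρ ^ m⌋₊, ?_⟩
    rintro N ⟨S, hSP, hS, rfl⟩
    rw [Nat.le_floor_iff (by positivity), le_div_iff₀ (by positivity)]
    exact card_mul_pow_le_of_separated hρ hR y S (fun z hz => hP (hSP hz)) hS
  obtain ⟨S, hSP, hS, hcard⟩ := Nat.sSup_mem hne hbdd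
  refine ⟨S, hSP, hS, fun z hz => ?_⟩
  by_contra! hcon
  have hzS : z ∉ S := fun h => by have := hcon z h; rw [dist_self] at this; linarith
  have hmem : S.card + 1 ∈ C := by
    refine ⟨insert z S, ?_, ?_, Finset.card_insert_of_notMem hzS⟩
    · rw [Finset.coe_insert]; exact Set.insert_subset hz hSP
    · rw [Finset.coe_insert]
      refine hS.insert fun b hb _ => ⟨(hcon b hb).le, ?_⟩
      rw [dist_comm]; exact (hcon b hb).le
  have := le_csSup hbdd hmem
  omega

lemma volume_near_rationals_le (u : ℝ) {r : ℝ} (hr : 0 ≤ r) {q M : ℕ} (hq : 0 < q) (hM : 0 < M) :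
    volume {t : ℝ | |t - u| ≤ r ∧ ∃ p : ℤ, |q * t - p| ≤ 1 / M} ≤
      ENNReal.ofReal ((2 * r + 3 / q) * (2 / M)) := by
  have hq' : (0 : ℝ) < q := by exact_mod_cast hq
  have hM' : (1 : ℝ) ≤ M := by exact_mod_cast hM
  have hM1 : (1 : ℝ) / M ≤ 1 := by rw [div_le_one (by linarith)]; exact hM'
  have hsub : {t : ℝ | |t - u| ≤ r ∧ ∃ p : ℤ, |q * t - p| ≤ 1 / M} ⊆
      ⋃ p ∈ Finset.Icc ⌈q * (u - r) - 1⌉ ⌊q * (u + r) + 1⌋,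
        Metric.closedBall ((p : ℝ) / q) (1 / (q * M)) := by
    rintro t ⟨ht, p, hp⟩
    have hp' := abs_le.1 hp
    rw [abs_le] at ht
    refine Set.mem_biUnion (x := p) ?_ ?_
    · simp only [Finset.coe_Icc, Set.mem_Icc, Int.ceil_le, Int.le_floor]
      constructor <;> nlinarith
    · rw [Metric.mem_closedBall, Real.dist_eq, show t - p / q = (q * t - p) / q by field_simp,
        abs_div, abs_of_pos hq', one_div, mul_inv, div_eq_inv_mul]
      rw [one_div] at hp
      gcongr
  refine (measure_mono hsub).trans ((measure_biUnion_finset_le _ _).trans ?_)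
  simp only [Real.volume_closedBall, Finset.sum_const, nsmul_eq_mul, Int.card_Icc]
  rw [← ENNReal.ofReal_natCast, ← ENNReal.ofReal_mul (by positivity)]
  refine ENNReal.ofReal_le_ofReal ?_
  have hcard : (((⌊q * (u + r) + 1⌋ + 1 - ⌈q * (u - r) - 1⌉).toNat : ℕ) : ℝ) ≤ 2 * q * r + 3 := by
    have h0 : (0 : ℝ) ≤ 2 * q * r + 3 := by positivity
    have h1 := Int.floor_le (q * (u + r) + 1)
    have h2 := Int.le_ceil (q * (u - r) - 1)
    rcases le_total 0 (⌊q * (u + r) + 1⌋ + 1 - ⌈q * (u - r) - 1⌉) with h | h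
    · have h3 : (((⌊q * (u + r) + 1⌋ + 1 - ⌈q * (u - r) - 1⌉).toNat : ℤ) : ℝ) =
          ((⌊q * (u + r) + 1⌋ + 1 - ⌈q * (u - r) - 1⌉ : ℤ) : ℝ) := by rw [Int.toNat_of_nonneg h]
      rw [Int.cast_natCast] at h3
      rw [h3]; push_cast; linarith
    · rw [Int.toNat_of_nonpos h]; simpa using h0
  calc _ ≤ (2 * q * r + 3) * (2 * (1 / (q * M))) := by gcongr
    _ = _ := by field_simp

lemma volume_near_rational_points_le {m : ℕ} (x : Fin m → ℝ) {r : ℝ} (hr : 0 ≤ r) {q M : ℕ}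
    (hq : 0 < q) (hM : 0 < M) :
    volume {ξ ∈ Metric.closedBall x r | ∃ p : Fin m → ℤ, ∀ i, |q * ξ i - p i| ≤ 1 / M} ≤
      ENNReal.ofReal (2 ^ m * (2 * r + 3 / q) ^ m / (M : ℝ) ^ m) := by
  have hsub : {ξ ∈ Metric.closedBall x r | ∃ p : Fin m → ℤ, ∀ i, |q * ξ i - p i| ≤ 1 / M} ⊆
      Set.univ.pi fun i => {t : ℝ | |t - x i| ≤ r ∧ ∃ p : ℤ, |q * t - p| ≤ 1 / M} := by
    rintro ξ ⟨hξ, p, hp⟩ i -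
    exact ⟨by rw [← Real.dist_eq]; exact (dist_le_pi_dist ξ x i).trans hξ, p i, hp i⟩
  refine (measure_mono hsub).trans ?_
  rw [volume_pi_pi]
  refine (Finset.prod_le_pow_card _ _ _ fun i _ =>
    volume_near_rationals_le (x i) hr hq hM).trans ?_
  rw [Finset.card_univ, Fintype.card_fin, ← ENNReal.ofReal_pow (by positivity)]
  refine ENNReal.ofReal_le_ofReal (le_of_eq ?_)
  rw [mul_pow, div_pow]; ring

/-- Points approximable by rationals of unusually small denominator are rare. -/
lemma volume_small_denominator_le {m : ℕ} (hm : 0 < m) {r : ℝ} (hr : 0 < r) :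
    ∃ M₀ : ℕ, ∀ M : ℕ, M₀ ≤ M → ∀ x : Fin m → ℝ,
      volume {ξ ∈ Metric.closedBall x r | ∃ q : ℕ, 1 ≤ q ∧ 4 * 5 ^ m * q ≤ M ^ m ∧
        ∃ p : Fin m → ℤ, ∀ i, |q * ξ i - p i| ≤ 1 / M} ≤ ENNReal.ofReal ((2 * r) ^ m / 2) := by
  obtain ⟨N, hN⟩ := exists_nat_ge (1 / r)
  obtain ⟨M₁, hM₁⟩ := exists_nat_ge (2 ^ m * (N * (2 * r + 3) ^ m) / ((2 * r) ^ m / 4))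
  refine ⟨max M₁ 1, fun M hM x => ?_⟩
  have hM0 : 0 < M := by have := le_max_right M₁ 1; omega
  have hMm : (M₁ : ℝ) ≤ (M : ℝ) ^ m := by
    have : M ≤ M ^ m := Nat.le_self_pow hm.ne' M
    have h2 := le_max_left M₁ 1
    exact_mod_cast (h2.trans hM).trans this
  have hMpos : (0 : ℝ) < (M : ℝ) ^ m := by positivity
  set D : ℕ := 4 * 5 ^ m with hD
  have hD0 : 0 < D := by positivity
  have hsub : {ξ ∈ Metric.closedBall x r | ∃ q : ℕ, 1 ≤ q ∧ D * q ≤ M ^ m ∧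
        ∃ p : Fin m → ℤ, ∀ i, |q * ξ i - p i| ≤ 1 / M} ⊆
      ⋃ q ∈ Finset.Icc 1 (M ^ m / D),
        {ξ ∈ Metric.closedBall x r | ∃ p : Fin m → ℤ, ∀ i, |q * ξ i - p i| ≤ 1 / M} := by
    rintro ξ ⟨hξ, q, hq1, hq2, hp⟩
    refine Set.mem_biUnion (x := q) ?_ ⟨hξ, hp⟩
    simp only [Finset.coe_Icc, Set.mem_Icc]
    exact ⟨hq1, (Nat.le_div_iff_mul_le hD0).2 (by linarith)⟩
  have hterm : ∀ q ∈ Finset.Icc 1 (M ^ m / D), 2 ^ m * (2 * r + 3 / (q : ℝ)) ^ m / (M : ℝ) ^ m ≤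
      2 ^ m / (M : ℝ) ^ m * ((5 * r) ^ m + if q ∈ Finset.Icc 1 N then (2 * r + 3) ^ m else 0) := by
    intro q hq
    have hq1 : (1 : ℝ) ≤ q := by exact_mod_cast (Finset.mem_Icc.1 hq).1
    rw [mul_div_right_comm]
    gcongr
    split_ifs with h
    · have : 2 * r + 3 / (q : ℝ) ≤ 2 * r + 3 := by
        gcongr; exact div_le_self (by norm_num) hq1
      have := pow_le_pow_left₀ (by positivity) this m
      have : 0 ≤ (5 * r) ^ m := by positivity
      linarith
    · have hNq : (N : ℝ) ≤ q := by
        have : N < q := by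
          by_contra! h'
          exact h (Finset.mem_Icc.2 ⟨(Finset.mem_Icc.1 hq).1, h'⟩)
        exact_mod_cast this.le
      have : 1 / r ≤ q := hN.trans hNq
      rw [div_le_iff₀ hr] at this
      rw [add_zero]
      refine pow_le_pow_left₀ (by positivity) ?_ m
      have : 3 / (q : ℝ) ≤ 3 * r := by rw [div_le_iff₀ (by linarith)]; linarith
      linarith
  refine (measure_mono hsub).trans ((measure_biUnion_finset_le _ _).trans ?_)
  calc _ ≤ ∑ q ∈ Finset.Icc 1 (M ^ m / D), ENNReal.ofReal (2 ^ m / (M : ℝ) ^ m *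
        ((5 * r) ^ m + if q ∈ Finset.Icc 1 N then (2 * r + 3) ^ m else 0)) := by
        refine Finset.sum_le_sum fun q hq => ?_
        exact (volume_near_rational_points_le x hr.le (Finset.mem_Icc.1 hq).1 hM0).trans
          (ENNReal.ofReal_le_ofReal (hterm q hq))
    _ ≤ _ := by
        rw [← ENNReal.ofReal_sum_of_nonneg fun q _ => by split_ifs <;> positivity]
        refine ENNReal.ofReal_le_ofReal ?_
        rw [← Finset.mul_sum, Finset.sum_add_distrib, Finset.sum_const, nsmul_eq_mul, Nat.card_Icc,
          ← Finset.sum_filter, Finset.sum_const, nsmul_eq_mul]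
        have h1 : (((Finset.Icc 1 (M ^ m / D)).filter (· ∈ Finset.Icc 1 N)).card : ℝ) ≤ N := by
          have : ((Finset.Icc 1 (M ^ m / D)).filter (· ∈ Finset.Icc 1 N)).card ≤ N := by
            calc _ ≤ (Finset.Icc 1 N).card :=
                  Finset.card_le_card fun q hq => (Finset.mem_filter.1 hq).2
              _ = N := by simp
          exact_mod_cast this
        have h2 : ((M ^ m / D + 1 - 1 : ℕ) : ℝ) ≤ (M : ℝ) ^ m / (4 * 5 ^ m) := by
          rw [Nat.add_sub_cancel]
          refine Nat.cast_div_le.trans (le_of_eq ?_)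
          rw [hD]; push_cast; rfl
        calc _ ≤ 2 ^ m / (M : ℝ) ^ m * ((M : ℝ) ^ m / (4 * 5 ^ m) * (5 * r) ^ m +
              N * (2 * r + 3) ^ m) := by gcongr
          _ = (2 * r) ^ m / 4 + 2 ^ m * (N * (2 * r + 3) ^ m) / (M : ℝ) ^ m := by
              rw [mul_pow, mul_pow]; field_simp
          _ ≤ (2 * r) ^ m / 4 + (2 * r) ^ m / 4 := by
              refine add_le_add le_rfl ?_
              rw [div_le_iff₀ hMpos]
              rw [div_le_iff₀ (by positivity)] at hM₁
              calc _ ≤ _ := hM₁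
                _ ≤ (M : ℝ) ^ m * ((2 * r) ^ m / 4) := by gcongr
                _ = _ := by ring
          _ = _ := by ring

/-- Rational points of `ℝ^m` with a common denominator at most `Q`. -/
def ratPts (m Q : ℕ) : Set (Fin m → ℝ) :=
  {η | ∃ q : ℕ, 1 ≤ q ∧ q ≤ Q ∧ ∃ p : Fin m → ℤ, ∀ i, η i = p i / q}

/-- The typical distance, up to a constant, between rational points of denominator about `M ^ m`. -/
noncomputable def netScale (m M : ℕ) : ℝ := 4 * 5 ^ m / (M : ℝ) ^ (m + 1)

lemma netScale_pos (m : ℕ) {M : ℕ} (hM : 0 < M) : 0 < netScale m M := by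
  have : (0 : ℝ) < M := by exact_mod_cast hM
  unfold netScale; positivity

lemma exists_rational_net {m : ℕ} (hm : 0 < m) {r : ℝ} (hr : 0 < r) :
    ∃ M₀ : ℕ, ∀ M : ℕ, M₀ ≤ M → netScale m M ≤ r ∧ ∀ x : Fin m → ℝ,
      ∃ S : Finset (Fin m → ℝ), (S : Set (Fin m → ℝ)) ⊆ ratPts m (M ^ m) ∧
        (∀ z ∈ S, dist z x ≤ 2 * r) ∧
        (S : Set (Fin m → ℝ)).Pairwise (fun a b => netScale m M ≤ dist a b) ∧
        (2 * r) ^ m / 2 ≤ S.card * (4 * netScale m M) ^ m := by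
  obtain ⟨M₁, hM₁⟩ := volume_small_denominator_le hm hr
  obtain ⟨M₂, hM₂⟩ := exists_nat_ge (4 * 5 ^ m / r)
  refine ⟨max (max M₁ M₂) 1, fun M hM => ?_⟩
  simp only [max_le_iff] at hM
  obtain ⟨⟨h1, h2⟩, h3⟩ := hM
  have hM0 : (0 : ℝ) < M := by exact_mod_cast h3
  have hρ0 := netScale_pos m h3
  have hρr : netScale m M ≤ r := by
    have h2' : (M₂ : ℝ) ≤ M := by exact_mod_cast h2
    have h4 : (M : ℝ) ≤ (M : ℝ) ^ (m + 1) :=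
      le_self_pow₀ (by exact_mod_cast h3) (by omega)
    unfold netScale
    rw [div_le_iff₀ hr] at hM₂
    rw [div_le_iff₀ (by positivity)]
    nlinarith
  refine ⟨hρr, fun x => ?_⟩
  set ρ := netScale m M with hρ
  obtain ⟨S, hSP, hsep, hcov⟩ := exists_finset_separated_cover hρ0 (by positivity : 0 ≤ 2 * r) x
    (ratPts m (M ^ m) ∩ Metric.closedBall x (2 * r)) Set.inter_subset_right
  refine ⟨S, fun z hz => (hSP hz).1, fun z hz => (hSP hz).2, hsep, ?_⟩
  set bad := {ξ ∈ Metric.closedBall x r | ∃ q : ℕ, 1 ≤ q ∧ 4 * 5 ^ m * q ≤ M ^ m ∧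
        ∃ p : Fin m → ℤ, ∀ i, |q * ξ i - p i| ≤ 1 / M}
  have hbad : volume.real bad ≤ (2 * r) ^ m / 2 :=
    ENNReal.toReal_le_of_le_ofReal (by positivity) (hM₁ M h1 x)
  have hbadfin : volume bad ≠ ⊤ := ((hM₁ M h1 x).trans_lt ENNReal.ofReal_lt_top).ne
  have hUfin : volume (⋃ s ∈ S, Metric.closedBall s (2 * ρ)) ≠ ⊤ :=
    (measure_biUnion_lt_top S.finite_toSet fun i _ => measure_closedBall_lt_top).ne
  have hsub : Metric.closedBall x r ⊆ bad ∪ ⋃ s ∈ S, Metric.closedBall s (2 * ρ) := by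
    intro ξ hξ
    obtain ⟨q, hq1, hqM, p, hp⟩ := exists_simultaneous_approx h3 ξ
    by_cases hD : 4 * 5 ^ m * q ≤ M ^ m
    · exact Or.inl ⟨hξ, q, hq1, hD, p, hp⟩
    · right
      have hq0 : (0 : ℝ) < q := by exact_mod_cast hq1
      have hD' : (M : ℝ) ^ m ≤ 4 * 5 ^ m * q := by exact_mod_cast (not_le.1 hD).le
      let η : Fin m → ℝ := fun i => p i / q
      have hdist : dist ξ η ≤ ρ := by
        rw [dist_pi_le_iff hρ0.le]
        intro i
        rw [Real.dist_eq, show ξ i - η i = (q * ξ i - p i) / q by simp only [η]; field_simp,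
          abs_div, abs_of_pos hq0, hρ, netScale, pow_succ]
        calc _ ≤ 1 / (M : ℝ) / q := by gcongr; exact hp i
          _ ≤ _ := by
            rw [div_div, div_le_div_iff₀ (by positivity) (by positivity)]
            nlinarith
      have hηx : dist η x ≤ 2 * r := by
        have := Metric.mem_closedBall.1 hξ
        linarith [dist_triangle η ξ x, dist_comm ξ η]
      obtain ⟨s, hs, hds⟩ := hcov η ⟨⟨q, hq1, hqM, p, fun i => rfl⟩, hηx⟩
      exact Set.mem_biUnion hs (by rw [Metric.mem_closedBall]; linarith [dist_triangle ξ η s])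
  have h5 : volume.real (⋃ s ∈ S, Metric.closedBall s (2 * ρ)) ≤ S.card * (4 * ρ) ^ m := by
    refine (measureReal_biUnion_finset_le _ _).trans (le_of_eq ?_)
    simp only [measureReal_pi_closedBall _ (by positivity : 0 ≤ 2 * ρ), Finset.sum_const,
      nsmul_eq_mul]
    ring
  have h6 := (measureReal_mono hsub (measure_union_ne_top hbadfin hUfin)).trans
    (measureReal_union_le _ _)
  rw [measureReal_pi_closedBall x hr.le] at h6
  linarith

lemma sum_inter_closedBall_le {m : ℕ} {ρ a a' : ℝ} (hρ : 0 < ρ) (ha' : 0 ≤ a') (haa : a' ≤ a)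
    (y : Fin m → ℝ) (S : Finset (Fin m → ℝ))
    (hsep : (S : Set (Fin m → ℝ)).Pairwise fun u v => ρ ≤ dist u v) :
    ∑ z ∈ S, volume.real (Metric.closedBall y a ∩ Metric.closedBall z a') ≤
      ((4 * a + ρ) / ρ) ^ m * (2 * a') ^ m := by
  have hcard : (((S.filter fun z => dist z y ≤ 2 * a).card : ℕ) : ℝ) ≤ ((4 * a + ρ) / ρ) ^ m := by
    rw [div_pow, le_div_iff₀ (by positivity)]
    have := card_mul_pow_le_of_separated hρ (by linarith : 0 ≤ 2 * a) y
      (S.filter fun z => dist z y ≤ 2 * a) (fun z hz => (Finset.mem_filter.1 hz).2)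
      (hsep.mono fun z hz => (Finset.mem_filter.1 hz).1)
    refine this.trans (le_of_eq ?_)
    ring
  calc _ ≤ ∑ z ∈ S, if dist z y ≤ 2 * a then (2 * a') ^ m else 0 := by
        refine Finset.sum_le_sum fun z _ => ?_
        split_ifs with h
        · rw [← measureReal_pi_closedBall z ha']
          exact measureReal_mono Set.inter_subset_right measure_closedBall_lt_top.ne
        · have : Metric.closedBall y a ∩ Metric.closedBall z a' = ∅ := by
            refine Set.eq_empty_of_forall_notMem fun w hw => h ?_
            have h1 := Metric.mem_closedBall.1 hw.1
            have h2 := Metric.mem_closedBall.1 hw.2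
            linarith [dist_triangle z w y, dist_comm z w]
          simp [this]
    _ = (S.filter fun z => dist z y ≤ 2 * a).card * (2 * a') ^ m := by
        rw [← Finset.sum_filter, Finset.sum_const, nsmul_eq_mul]
    _ ≤ _ := by gcongr

lemma sum_sum_inter_closedBall_le {m : ℕ} (hm : 0 < m) {r ρ ρ' a a' : ℝ} (hρ' : 0 < ρ')
    (hρρ : ρ' ≤ ρ) (hρr : ρ ≤ r) (ha' : 0 ≤ a') (haa : a' ≤ a) (x : Fin m → ℝ)
    (S S' : Finset (Fin m → ℝ)) (hS : ∀ z ∈ S, dist z x ≤ 2 * r)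
    (hsep : (S : Set (Fin m → ℝ)).Pairwise fun u v => ρ ≤ dist u v)
    (hsep' : (S' : Set (Fin m → ℝ)).Pairwise fun u v => ρ' ≤ dist u v) :
    ∑ y ∈ S, ∑ z ∈ S', volume.real (Metric.closedBall y a ∩ Metric.closedBall z a') ≤
      (80 * r) ^ m * ((a' / ρ') ^ m * ((a / ρ) ^ m + ρ' / ρ)) := by
  have hρ : 0 < ρ := hρ'.trans_le hρρ
  have ha : 0 ≤ a := ha'.trans haa
  have hr : 0 < r := hρ.trans_le hρr
  have hcard : (S.card : ℝ) ≤ (5 * r / ρ) ^ m := by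
    rw [div_pow, le_div_iff₀ (by positivity)]
    refine (card_mul_pow_le_of_separated hρ (by linarith : 0 ≤ 2 * r) x S hS hsep).trans ?_
    gcongr; linarith
  have hpow : (4 * (a / ρ) + ρ' / ρ) ^ m ≤ 8 ^ m * ((a / ρ) ^ m + ρ' / ρ) := by
    have h1 : ρ' / ρ ≤ 1 := (div_le_one hρ).2 hρρ
    have h2 : (ρ' / ρ) ^ m ≤ ρ' / ρ := pow_le_of_le_one (by positivity) h1 hm.ne'
    calc _ ≤ 2 ^ (m - 1) * ((4 * (a / ρ)) ^ m + (ρ' / ρ) ^ m) :=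
          add_pow_le (by positivity) (by positivity) m
      _ ≤ 2 ^ m * (4 ^ m * (a / ρ) ^ m + 4 ^ m * (ρ' / ρ)) := by
          rw [mul_pow]
          have : (1 : ℝ) ≤ 4 ^ m := one_le_pow₀ (by norm_num)
          have h3 : ρ' / ρ ≤ 4 ^ m * (ρ' / ρ) := le_mul_of_one_le_left (by positivity) this
          have h4 : (2 : ℝ) ^ (m - 1) ≤ 2 ^ m := pow_le_pow_right₀ (by norm_num) (by omega)
          have h5 := h2.trans h3
          gcongr
      _ = _ := by rw [show (8 : ℝ) = 2 * 4 by norm_num, mul_pow]; ring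
  calc _ ≤ ∑ y ∈ S, ((4 * a + ρ') / ρ') ^ m * (2 * a') ^ m :=
        Finset.sum_le_sum fun y _ => sum_inter_closedBall_le hρ' ha' haa y S' hsep'
    _ = S.card * (((4 * a + ρ') / ρ') ^ m * (2 * a') ^ m) := by rw [Finset.sum_const, nsmul_eq_mul]
    _ ≤ (5 * r / ρ) ^ m * (((4 * a + ρ') / ρ') ^ m * (2 * a') ^ m) := by gcongr
    _ = (10 * r) ^ m * (a' / ρ') ^ m * (4 * (a / ρ) + ρ' / ρ) ^ m := by
        rw [← mul_pow, ← mul_pow, ← mul_pow, ← mul_pow]; congr 1; field_simp; ring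
    _ ≤ (10 * r) ^ m * (a' / ρ') ^ m * (8 ^ m * ((a / ρ) ^ m + ρ' / ρ)) := by gcongr
    _ = _ := by rw [show 80 * r = 10 * r * 8 by ring, mul_pow (10 * r) 8]; ring

lemma netScale_div_le {m k l : ℕ} (hkl : k ≤ l) :
    netScale m (2 ^ l) / netScale m (2 ^ k) ≤ (1 / 2 : ℝ) ^ (l - k) := by
  obtain ⟨j, rfl⟩ := Nat.exists_eq_add_of_le hkl
  have : netScale m (2 ^ (k + j)) / netScale m (2 ^ k) = ((1 / 2 : ℝ) ^ j) ^ (m + 1) := by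
    unfold netScale
    push_cast
    rw [pow_add (2 : ℝ) k j, mul_pow, one_div_pow, one_div_pow]
    field_simp
  rw [this, Nat.add_sub_cancel_left]
  exact pow_le_of_le_one (by positivity) (pow_le_one₀ (by norm_num) (by norm_num)) (by omega)

lemma sum_sum_geometric_le (J : Finset ℕ) (w : ℕ → ℝ) (hw : ∀ k, 0 ≤ w k) :
    ∑ k ∈ J, ∑ l ∈ J, (if k ≤ l then w l * (1 / 2 : ℝ) ^ (l - k) else 0) ≤ 2 * ∑ k ∈ J, w k := by
  rw [Finset.sum_comm, Finset.mul_sum]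
  refine Finset.sum_le_sum fun l _ => ?_
  calc _ ≤ ∑ k ∈ Finset.range (l + 1), w l * (1 / 2 : ℝ) ^ (l - k) := by
        rw [← Finset.sum_filter]
        refine Finset.sum_le_sum_of_subset_of_nonneg (fun k hk => ?_) fun k _ _ => ?_
        · simp only [Finset.mem_filter] at hk; simp; omega
        · have := hw l; positivity
    _ = w l * ∑ k ∈ Finset.range (l + 1), (1 / 2 : ℝ) ^ k := by
        rw [← Finset.mul_sum, ← Finset.sum_range_reflect (fun k => (1 / 2 : ℝ) ^ k) (l + 1)]
        simp only [Nat.add_sub_cancel]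
    _ ≤ w l * 2 := by gcongr; exacts [hw l, sum_geometric_two_le _]
    _ = _ := mul_comm _ _

lemma measureReal_limsup_local_ge {m : ℕ} (hm : 0 < m) {a : ℕ → ℝ} (ha0 : ∀ k, 0 ≤ a k)
    (haρ : ∀ k, a k ≤ netScale m (2 ^ k)) (hanti : Antitone a)
    (hdiv : ¬ Summable fun k => (a k / netScale m (2 ^ k)) ^ m) (K : ℕ) (x : Fin m → ℝ)
    {r : ℝ} (hr : 0 < r) :
    r ^ m / (20 * 80 ^ m) ≤ volume.real (Metric.closedBall x (3 * r) ∩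
      ⋃ k ≥ K, ⋃ z ∈ ratPts m ((2 ^ k) ^ m), Metric.closedBall z (a k)) := by
  obtain ⟨M₀, hM₀⟩ := exists_rational_net hm hr
  set ρ : ℕ → ℝ := fun k => netScale m (2 ^ k) with hρdef
  have hρ0 : ∀ k, 0 < ρ k := fun k => netScale_pos m (by positivity)
  have hρle : ∀ {k l}, k ≤ l → ρ l / ρ k ≤ (1 / 2 : ℝ) ^ (l - k) := fun h => netScale_div_le h
  have hρanti : ∀ {k l}, k ≤ l → ρ l ≤ ρ k := fun {k l} h => by
    have := (hρle h).trans (pow_le_one₀ (by norm_num) (by norm_num))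
    exact (div_le_one (hρ0 k)).1 this
  set w : ℕ → ℝ := fun k => (a k / ρ k) ^ m with hw
  have hw0 : ∀ k, 0 ≤ w k := fun k => pow_nonneg (div_nonneg (ha0 k) (hρ0 k).le) m
  set K' := max K M₀ with hK'
  have hge : ∀ k, M₀ ≤ 2 ^ (K' + k) := fun k => by
    have := (Nat.lt_two_pow_self (n := K' + k)).le
    have := le_max_right K M₀
    omega
  have hnet := fun k => hM₀ (2 ^ (K' + k)) (hge k)
  choose hρr hnet using hnet
  choose S hSP hSx hSsep hScard using fun k => hnet k x
  have hdiv' : ¬ Summable fun k => w (k + K') := fun h => hdiv ((summable_nat_add_iff K').1 h)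
  obtain ⟨L, hL⟩ : ∃ L, 1 ≤ ∑ k ∈ Finset.range L, w (K' + k) := by
    by_contra! h
    refine hdiv' (summable_of_sum_range_le (c := 1) (fun k => hw0 _) fun n => ?_)
    simpa [add_comm] using (h n).le
  set J := Finset.range L with hJ
  set σ := ∑ k ∈ J, w (K' + k) with hσ
  let T : Finset (Σ _ : ℕ, Fin m → ℝ) := J.sigma S
  let A : (Σ _ : ℕ, Fin m → ℝ) → Set (Fin m → ℝ) := fun i => Metric.closedBall i.2 (a (K' + i.1))
  have hmain := measureReal_biUnion_ge_second_moment volume T A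
    (fun i => measurableSet_closedBall) (fun i => measure_closedBall_lt_top.ne)
    (1 / (10 * 80 ^ m * σ))
  have hsub : (⋃ i ∈ T, A i) ⊆ Metric.closedBall x (3 * r) ∩
      ⋃ k ≥ K, ⋃ z ∈ ratPts m ((2 ^ k) ^ m), Metric.closedBall z (a k) := by
    refine Set.iUnion₂_subset fun i hi ξ hξ => ?_
    obtain ⟨hi1, hi2⟩ := Finset.mem_sigma.1 hi
    have hξ' := Metric.mem_closedBall.1 hξ
    refine ⟨?_, ?_⟩
    · rw [Metric.mem_closedBall]
      linarith [dist_triangle ξ i.2 x, hSx _ _ hi2, haρ (K' + i.1), hρr i.1]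
    · simp only [Set.mem_iUnion]
      exact ⟨K' + i.1, (le_max_left K M₀).trans (Nat.le_add_right _ _), i.2, hSP _ hi2, hξ⟩
  refine le_trans ?_ (hmain.trans (measureReal_mono hsub
    (measure_ne_top_of_subset Set.inter_subset_left measure_closedBall_lt_top.ne)))
  have hfirst : r ^ m / 2 * σ ≤ ∑ i ∈ T, volume.real (A i) := by
    rw [Finset.sum_sigma, hσ, Finset.mul_sum]
    refine Finset.sum_le_sum fun k _ => ?_
    simp only [A, measureReal_pi_closedBall _ (ha0 _), Finset.sum_const, nsmul_eq_mul]
    have h1 := hScard k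
    change (2 * r) ^ m / 2 ≤ (S k).card * (4 * ρ (K' + k)) ^ m at h1
    have h2 : (0 : ℝ) ≤ (2 * a (K' + k) / (4 * ρ (K' + k))) ^ m :=
      pow_nonneg (div_nonneg (mul_nonneg zero_le_two (ha0 _))
        (mul_nonneg zero_le_four (hρ0 _).le)) m
    have hρk := hρ0 (K' + k)
    calc _ = (2 * r) ^ m / 2 * (2 * a (K' + k) / (4 * ρ (K' + k))) ^ m := by
          simp only [hw]
          rw [div_mul_eq_mul_div, div_mul_eq_mul_div, ← mul_pow, ← mul_pow]
          congr 2; field_simp; norm_num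
      _ ≤ (S k).card * (4 * ρ (K' + k)) ^ m * (2 * a (K' + k) / (4 * ρ (K' + k))) ^ m :=
          mul_le_mul_of_nonneg_right h1 h2
      _ = _ := by
          rw [mul_assoc, ← mul_pow]; congr 2; field_simp
  have hpair : ∀ k l, k ≤ l → ∑ y ∈ S k, ∑ z ∈ S l, volume.real (Metric.closedBall y (a (K' + k)) ∩
      Metric.closedBall z (a (K' + l))) ≤
      (80 * r) ^ m * (w (K' + l) * (w (K' + k) + (1 / 2 : ℝ) ^ (l - k))) := by
    intro k l hkl
    refine (sum_sum_inter_closedBall_le hm (hρ0 (K' + l)) (hρanti (by omega)) (hρr k) (ha0 _)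
      (hanti (by omega)) x (S k) (S l) (hSx k) (hSsep k) (hSsep l)).trans ?_
    have h1 := hρle (show K' + k ≤ K' + l by omega)
    rw [Nat.add_sub_add_left] at h1
    have h2 := hw0 (K' + l)
    gcongr
  have hpair' : ∀ k l, ∑ y ∈ S k, ∑ z ∈ S l, volume.real (Metric.closedBall y (a (K' + k)) ∩
      Metric.closedBall z (a (K' + l))) ≤
      (80 * r) ^ m * (w (K' + k) * w (K' + l) +
        ((if k ≤ l then w (K' + l) * (1 / 2 : ℝ) ^ (l - k) else 0) +
         (if l ≤ k then w (K' + k) * (1 / 2 : ℝ) ^ (k - l) else 0))) := by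
    intro k l
    have hnn : ∀ i j, 0 ≤ w (K' + i) * (1 / 2 : ℝ) ^ j := fun i j =>
      mul_nonneg (hw0 _) (by positivity)
    rcases le_total k l with h | h
    · refine (hpair k l h).trans (mul_le_mul_of_nonneg_left ?_ (by positivity))
      rw [if_pos h]
      have : 0 ≤ (if l ≤ k then w (K' + k) * (1 / 2 : ℝ) ^ (k - l) else 0) := by
        split_ifs; exacts [hnn _ _, le_rfl]
      nlinarith
    · rw [Finset.sum_comm]
      simp_rw [Set.inter_comm (Metric.closedBall _ (a (K' + k)))]
      refine (hpair l k h).trans (mul_le_mul_of_nonneg_left ?_ (by positivity))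
      rw [if_pos h]
      have : 0 ≤ (if k ≤ l then w (K' + l) * (1 / 2 : ℝ) ^ (l - k) else 0) := by
        split_ifs; exacts [hnn _ _, le_rfl]
      nlinarith
  have hσ1 : 1 ≤ σ := hL
  have hsecond : ∑ i ∈ T, ∑ j ∈ T, volume.real (A i ∩ A j) ≤ (80 * r) ^ m * (5 * σ ^ 2) := by
    have e : ∑ i ∈ T, ∑ j ∈ T, volume.real (A i ∩ A j) = ∑ k ∈ J, ∑ l ∈ J, ∑ y ∈ S k, ∑ z ∈ S l,
        volume.real (Metric.closedBall y (a (K' + k)) ∩ Metric.closedBall z (a (K' + l))) := by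
      rw [Finset.sum_sigma]
      refine Finset.sum_congr rfl fun k _ => ?_
      refine Eq.trans ?_ Finset.sum_comm
      exact Finset.sum_congr rfl fun y _ => Finset.sum_sigma _ _ _
    rw [e]
    refine (Finset.sum_le_sum fun k _ => Finset.sum_le_sum fun l _ => hpair' k l).trans ?_
    simp only [← Finset.mul_sum, Finset.sum_add_distrib]
    refine mul_le_mul_of_nonneg_left ?_ (by positivity)
    have h1 := sum_sum_geometric_le J (fun k => w (K' + k)) fun k => hw0 _
    have h2 := h1
    rw [Finset.sum_comm] at h2
    rw [← Finset.sum_mul, ← hσ]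
    rw [← hσ] at h1 h2
    nlinarith
  have hr' : 0 < r ^ m := by positivity
  have h80 : (0 : ℝ) < 80 ^ m := by positivity
  calc r ^ m / (20 * 80 ^ m) = 2 * (1 / (10 * 80 ^ m * σ)) * (r ^ m / 2 * σ) -
        (1 / (10 * 80 ^ m * σ)) ^ 2 * ((80 * r) ^ m * (5 * σ ^ 2)) := by
        rw [mul_pow]; field_simp; norm_num
    _ ≤ _ := by gcongr

/-- Divergence part of the simultaneous Khintchine theorem along powers of two. -/
theorem ae_frequently_near_rational {m : ℕ} (hm : 0 < m) {a : ℕ → ℝ} (ha0 : ∀ k, 0 ≤ a k)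
    (haρ : ∀ k, a k ≤ netScale m (2 ^ k)) (hanti : Antitone a)
    (hdiv : ¬ Summable fun k => (a k / netScale m (2 ^ k)) ^ m) :
    ∀ᵐ ξ : Fin m → ℝ, ∀ K : ℕ, ∃ k ≥ K, ∃ z ∈ ratPts m ((2 ^ k) ^ m), dist ξ z ≤ a k := by
  have hcount : ∀ Q, (ratPts m Q).Countable := by
    intro Q
    refine (Set.countable_range fun v : ℕ × (Fin m → ℤ) => fun i => (v.2 i : ℝ) / v.1).mono ?_
    rintro η ⟨q, -, -, p, hp⟩
    exact ⟨(q, p), (funext hp).symm⟩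
  rw [ae_all_iff]
  intro K
  set U := ⋃ k ≥ K, ⋃ z ∈ ratPts m ((2 ^ k) ^ m), Metric.closedBall z (a k) with hU
  have hUmeas : MeasurableSet U :=
    MeasurableSet.iUnion fun k => MeasurableSet.iUnion fun _ =>
      MeasurableSet.biUnion (hcount _) fun z _ => measurableSet_closedBall
  suffices h : volume Uᶜ = 0 by
    rw [ae_iff]
    convert h using 2
    ext ξ
    simp [hU]
  have hdens := Besicovitch.ae_tendsto_measure_inter_div (volume : Measure (Fin m → ℝ)) Uᶜ
  have hfalse : ∀ x : Fin m → ℝ, ¬ Filter.Tendsto (fun r => volume (Uᶜ ∩ Metric.closedBall x r) /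
      volume (Metric.closedBall x r)) (nhdsWithin 0 (Set.Ioi 0)) (nhds 1) := by
    intro x hx
    set c : ℝ := 1 / (6 ^ m * (20 * 80 ^ m)) with hc
    have hc0 : 0 < c := by positivity
    have hle : ∀ r : ℝ, 0 < r → volume (Uᶜ ∩ Metric.closedBall x r) /
        volume (Metric.closedBall x r) ≤ ENNReal.ofReal (1 - c) := by
      intro r hr
      have hball := measureReal_pi_closedBall x hr.le
      have hfin : volume (Metric.closedBall x r) ≠ ⊤ := measure_closedBall_lt_top.ne
      have h1 := measureReal_limsup_local_ge hm ha0 haρ hanti hdiv K x (r := r / 3) (by positivity)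
      rw [mul_div_cancel₀ r (by norm_num : (3 : ℝ) ≠ 0), ← hU] at h1
      have h2 := measureReal_inter_add_sdiff (μ := volume) (s := Metric.closedBall x r) hUmeas hfin
      have h3 : volume.real (Uᶜ ∩ Metric.closedBall x r) ≤ (1 - c) * (2 * r) ^ m := by
        rw [Set.inter_comm, ← Set.sdiff_eq]
        have : c * (2 * r) ^ m = (r / 3) ^ m / (20 * 80 ^ m) := by
          rw [hc, show (6 : ℝ) = 2 * 3 by norm_num, mul_pow, mul_pow, div_pow]; field_simp
        linarith
      refine ENNReal.div_le_of_le_mul ?_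
      have hne : volume (Uᶜ ∩ Metric.closedBall x r) ≠ ⊤ :=
        measure_ne_top_of_subset Set.inter_subset_right hfin
      have hc1 : 0 ≤ 1 - c := by
        have := measureReal_nonneg (μ := volume) (s := Uᶜ ∩ Metric.closedBall x r)
        have h4 : 0 < (2 * r) ^ m := by positivity
        by_contra! h5
        nlinarith
      rw [← ENNReal.ofReal_toReal hfin, ← ENNReal.ofReal_toReal hne, ← ENNReal.ofReal_mul hc1]
      exact ENNReal.ofReal_le_ofReal (by rw [← measureReal_def, ← measureReal_def, hball]; exact h3)
    have h1 : (1 : ENNReal) ≤ ENNReal.ofReal (1 - c) :=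
      le_of_tendsto hx (eventually_nhdsWithin_of_forall fun r hr => hle r hr)
    rw [ENNReal.one_le_ofReal] at h1
    linarith
  have h0 : (volume.restrict Uᶜ : Measure (Fin m → ℝ)) = 0 := by
    rw [← ae_eq_bot, ← Filter.eventually_false_iff_eq_bot]
    exact hdens.mono fun x hx => hfalse x hx
  simpa using h0

lemma not_summable_min_along_powers {m : ℕ} {ψ : ℕ → ℝ} (hψ : ∀ q, 0 ≤ ψ q) (hmono : Antitone ψ)
    (hdiv : ¬ Summable fun q : ℕ => (q : ℝ) ^ m * ψ q ^ m) {R : ℕ} (hR : 0 < R) {c : ℝ}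
    (hc : 0 < c) (hm : 0 < m) :
    ¬ Summable fun k => (min (c * ψ (R * (2 ^ k) ^ m)) (netScale m (2 ^ k)) /
      netScale m (2 ^ k)) ^ m := by
  intro hsum
  apply hdiv
  set u : ℕ → ℕ := fun k => R * (2 ^ k) ^ m with hu
  have hρ0 : ∀ k, 0 < netScale m (2 ^ k) := fun k => netScale_pos m (by positivity)
  have h1 : Summable fun k => (c * ψ (u k) / netScale m (2 ^ k)) ^ m := by
    refine hsum.congr_atTop ?_
    filter_upwards [hsum.tendsto_atTop_zero.eventually_lt_const one_pos] with k hk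
    have hlt : min (c * ψ (u k)) (netScale m (2 ^ k)) < netScale m (2 ^ k) := by
      by_contra! h
      rw [min_eq_right (le_min_iff.1 h).1, div_self (hρ0 k).ne', one_pow] at hk
      exact lt_irrefl _ hk
    rw [min_eq_left ((min_lt_iff.1 hlt).resolve_right (lt_irrefl _)).le]
  set t : ℕ → ℝ := fun k => (u (k + 1) : ℝ) * ((u (k + 1) : ℝ) ^ m * ψ (u k) ^ m) with ht
  have ht0 : ∀ k, 0 ≤ t k := fun k => by have := hψ (u k); positivity
  have h2 : Summable t := by
    refine (h1.mul_left (((R * 2 ^ m : ℕ) : ℝ) ^ (m + 1) * (4 * 5 ^ m / c) ^ m)).congr fun k => ?_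
    simp only [ht, hu, netScale]
    push_cast
    have h4 : ((2 : ℝ) ^ (k + 1)) ^ m = 2 ^ m * (2 ^ k) ^ m := by rw [← mul_pow, ← pow_succ']
    rw [h4]
    set b : ℝ := 2 ^ k with hb
    have hb0 : b ≠ 0 := by positivity
    have hcn : c * ψ (R * (2 ^ k) ^ m) / (4 * 5 ^ m / b ^ (m + 1)) =
        c / (4 * 5 ^ m) * (b ^ (m + 1) * ψ (R * (2 ^ k) ^ m)) := by field_simp
    have hcc : (4 * 5 ^ m / c) ^ m * (c / (4 * 5 ^ m)) ^ m = 1 := by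
      rw [← mul_pow]
      have : 4 * 5 ^ m / c * (c / (4 * 5 ^ m)) = 1 := by field_simp
      rw [this, one_pow]
    rw [hcn, mul_pow (c / (4 * 5 ^ m)), mul_assoc, ← mul_assoc _ ((c / (4 * 5 ^ m)) ^ m), hcc,
      one_mul, mul_pow (b ^ (m + 1)), ← pow_mul, mul_comm (m + 1) m, pow_mul, ← mul_assoc,
      ← mul_pow, mul_assoc (R : ℝ), pow_succ]
    ring
  have hmonou : Monotone u := fun i j hij => by
    simp only [hu]; gcongr; norm_num
  have h3 : ∀ n, ∑ q ∈ Finset.range (u n), (q : ℝ) ^ m * ψ q ^ m ≤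
      ∑ q ∈ Finset.range (u 0), (q : ℝ) ^ m * ψ q ^ m + ∑ k ∈ Finset.range n, t k := by
    intro n
    induction n with
    | zero => simp
    | succ n ih =>
      rw [Finset.sum_range_succ, ← Finset.sum_range_add_sum_Ico _ (hmonou n.le_succ)]
      have : ∑ q ∈ Finset.Ico (u n) (u (n + 1)), (q : ℝ) ^ m * ψ q ^ m ≤ t n := by
        calc _ ≤ ∑ q ∈ Finset.Ico (u n) (u (n + 1)), (u (n + 1) : ℝ) ^ m * ψ (u n) ^ m := by
              refine Finset.sum_le_sum fun q hq => ?_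
              rw [Finset.mem_Ico] at hq
              have h4 := hmono hq.1
              have h5 : (q : ℝ) ≤ u (n + 1) := by exact_mod_cast hq.2.le
              have h6 := hψ q
              gcongr
          _ ≤ _ := by
              rw [Finset.sum_const, Nat.card_Ico, nsmul_eq_mul]
              have h6 := hψ (u n)
              simp only [ht]
              gcongr
              exact Nat.sub_le _ _
      linarith
  refine summable_of_sum_range_le
    (c := ∑ q ∈ Finset.range (u 0), (q : ℝ) ^ m * ψ q ^ m + ∑' k, t k)
    (fun q => mul_nonneg (by positivity) (pow_nonneg (hψ q) m)) fun n => ?_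
  have hnu : n ≤ u n := by
    calc n ≤ 2 ^ n := Nat.lt_two_pow_self.le
      _ ≤ (2 ^ n) ^ m := Nat.le_self_pow hm.ne' _
      _ ≤ _ := Nat.le_mul_of_pos_left _ hR
  calc _ ≤ ∑ q ∈ Finset.range (u n), (q : ℝ) ^ m * ψ q ^ m :=
        Finset.sum_le_sum_of_subset_of_nonneg (Finset.range_subset_range.2 hnu)
          fun q _ _ => mul_nonneg (by positivity) (pow_nonneg (hψ q) m)
    _ ≤ _ := (h3 n).trans (by gcongr; exact h2.sum_le_tsum _ fun k _ => ht0 k)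

lemma eNorm_smul {n : ℕ} (s : ℝ) (x : Fin n → ℝ) : eNorm (s • x) = |s| * eNorm x := by
  unfold eNorm
  rw [← Real.sqrt_sq_eq_abs, ← Real.sqrt_mul (sq_nonneg s), Finset.mul_sum]
  simp [mul_pow]

lemma wedgeNorm_smul_smul {n : ℕ} (s t : ℝ) (x y : Fin n → ℝ) :
    wedgeNorm (s • x) (t • y) = |s * t| * wedgeNorm x y := by
  unfold wedgeNorm
  rw [← Real.sqrt_sq_eq_abs, ← Real.sqrt_mul (sq_nonneg _), Finset.mul_sum]
  congr 1
  refine Finset.sum_congr rfl fun ij _ => ?_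
  simp only [Pi.smul_apply, smul_eq_mul]; ring

lemma abs_le_eNorm {n : ℕ} (x : Fin n → ℝ) (i : Fin n) : |x i| ≤ eNorm x := by
  rw [← Real.sqrt_sq_eq_abs]
  exact Real.sqrt_le_sqrt (Finset.single_le_sum (f := fun i => x i ^ 2)
    (fun i _ => sq_nonneg _) (Finset.mem_univ i))

lemma wedgeNorm_le {n : ℕ} (x y : Fin n → ℝ) :
    wedgeNorm x y ≤ 2 * n * (eNorm x * dist x y) := by
  have h0 : 0 ≤ eNorm x := Real.sqrt_nonneg _
  have hd : ∀ i, |y i - x i| ≤ dist x y := fun i => by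
    rw [abs_sub_comm, ← Real.dist_eq]; exact dist_le_pi_dist x y i
  unfold wedgeNorm
  refine Real.sqrt_le_iff.2 ⟨by positivity, ?_⟩
  calc _ ≤ ∑ ij : Fin n × Fin n, (x ij.1 * y ij.2 - x ij.2 * y ij.1) ^ 2 :=
        Finset.sum_le_sum_of_subset_of_nonneg (Finset.filter_subset _ _) fun _ _ _ => sq_nonneg _
    _ ≤ ∑ ij : Fin n × Fin n, (2 * (eNorm x * dist x y)) ^ 2 := by
        refine Finset.sum_le_sum fun ij _ => sq_le_sq' ?_ ?_ <;>
        · have h1 : |x ij.1 * (y ij.2 - x ij.2)| ≤ eNorm x * dist x y := by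
            rw [abs_mul]; exact mul_le_mul (abs_le_eNorm x _) (hd _) (abs_nonneg _) h0
          have h2 : |x ij.2 * (y ij.1 - x ij.1)| ≤ eNorm x * dist x y := by
            rw [abs_mul]; exact mul_le_mul (abs_le_eNorm x _) (hd _) (abs_nonneg _) h0
          rw [abs_le] at h1 h2
          linarith
    _ = _ := by
        rw [Finset.sum_const, Finset.card_univ, Fintype.card_prod, Fintype.card_fin, nsmul_eq_mul]
        push_cast; ring

lemma deltaInf_smul_cons_le {m : ℕ} {s t : ℝ} (hs : s ≠ 0) (ht : t ≠ 0) (ξ η : Fin m → ℝ) :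
    deltaInf (s • (Fin.cons 1 ξ : Fin (m + 1) → ℝ)) (t • (Fin.cons 1 η : Fin (m + 1) → ℝ)) ≤
      2 * (m + 1) * dist ξ η := by
  set X : Fin (m + 1) → ℝ := Fin.cons 1 ξ
  set Y : Fin (m + 1) → ℝ := Fin.cons 1 η
  have hX : 1 ≤ eNorm X := by simpa [X] using abs_le_eNorm X 0
  have hY : 1 ≤ eNorm Y := by simpa [Y] using abs_le_eNorm Y 0
  have hd : dist X Y ≤ dist ξ η := by
    rw [dist_pi_le_iff dist_nonneg]
    refine Fin.cases ?_ fun i => ?_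
    · simp [X, Y]
    · simpa [X, Y] using dist_le_pi_dist ξ η i
  have hw := wedgeNorm_le X Y
  have hst : 0 < |s| * |t| := by positivity
  unfold deltaInf
  rw [eNorm_smul, eNorm_smul, wedgeNorm_smul_smul, abs_mul,
    show |s| * eNorm X * (|t| * eNorm Y) = |s| * |t| * (eNorm X * eNorm Y) by ring,
    mul_div_mul_left _ _ hst.ne', div_le_iff₀ (by positivity)]
  push_cast at hw
  calc _ ≤ _ := hw
    _ ≤ 2 * (m + 1) * (eNorm X * dist ξ η) := by gcongr
    _ ≤ 2 * (m + 1) * (eNorm X * dist ξ η) * eNorm Y := le_mul_of_one_le_right (by positivity) hY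
    _ = _ := by ring

lemma exists_isPrim_mul_eq {n : ℕ} {V : Fin n → ℤ} {i : Fin n} (hV : V i ≠ 0) :
    ∃ (v : Fin n → ℤ) (g : ℤ), g ≠ 0 ∧ IsPrim v ∧ ∀ b, V b = g * v b := by
  obtain ⟨v, hv, hg⟩ := Finset.extract_gcd V ⟨i, Finset.mem_univ i⟩
  refine ⟨v, Finset.univ.gcd V, fun h => hV ?_, hg, fun b => hv b (Finset.mem_univ b)⟩
  rw [hv i (Finset.mem_univ i), h, zero_mul]

/-- A rational point of denominator at most `Q` close to `ξ` has projective height `O(Q)`. -/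
lemma exists_isPrim_smul_cons {m Q R : ℕ} (hR : 1 ≤ R) {ξ : Fin m → ℝ} {η : Fin m → ℚ} {r : ℝ}
    (hRξ : ‖ξ‖ + r ≤ R) (hη : (fun i => (η i : ℝ)) ∈ ratPts m Q)
    (hd : dist ξ (fun i => (η i : ℝ)) ≤ r) :
    ∃ (v : Fin (m + 1) → ℤ) (t : ℚ), t ≠ 0 ∧ IsPrim v ∧ Hsup v ≤ R * Q ∧
      intRat v = t • (Fin.cons 1 η : Fin (m + 1) → ℚ) := by
  obtain ⟨q, hq1, hqQ, p, hp⟩ := hη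
  have hq0 : (q : ℝ) ≠ 0 := by positivity
  have hpq : ∀ i, (p i : ℚ) = q * η i := fun i => by
    have h1 : (p i : ℝ) = q * η i := by
      have := hp i
      simp only at this
      rw [this]; field_simp
    exact_mod_cast h1
  have hV : (Fin.cons (q : ℤ) p : Fin (m + 1) → ℤ) 0 ≠ 0 := by simp; omega
  obtain ⟨v, g, hg, hprim, hv⟩ := exists_isPrim_mul_eq hV
  have hgq : (g : ℚ) ≠ 0 := by exact_mod_cast hg
  have hqq : (q : ℚ) ≠ 0 := by positivity
  refine ⟨v, q / g, by positivity, hprim, Finset.sup_le fun b _ => ?_, funext fun b => ?_⟩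
  · have h1 : (v b).natAbs ≤ ((Fin.cons (q : ℤ) p : Fin (m + 1) → ℤ) b).natAbs := by
      rw [hv b, Int.natAbs_mul]
      exact Nat.le_mul_of_pos_left _ (Int.natAbs_pos.2 hg)
    refine h1.trans ?_
    cases b using Fin.cases with
    | zero => simpa using hqQ.trans (Nat.le_mul_of_pos_left _ hR)
    | succ i =>
      simp only [Fin.cons_succ]
      have h2 : ‖fun i => (η i : ℝ)‖ ≤ R := by
        calc _ ≤ ‖ξ‖ + dist ξ (fun i => (η i : ℝ)) := by
              rw [dist_eq_norm]; exact norm_le_norm_add_norm_sub _ _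
          _ ≤ _ := by linarith
      have h3 : |(η i : ℝ)| ≤ R := (norm_le_pi_norm (fun i => (η i : ℝ)) i).trans h2
      have h4 : ((p i).natAbs : ℝ) ≤ R * Q := by
        rw [Nat.cast_natAbs, Int.cast_abs, show (p i : ℝ) = q * η i by exact_mod_cast hpq i,
          abs_mul, Nat.abs_cast, mul_comm]
        gcongr
      exact_mod_cast h4
  · have h1 : ((Fin.cons (q : ℤ) p : Fin (m + 1) → ℤ) b : ℚ) = g * v b := by
      exact_mod_cast hv b
    have h2 : ((Fin.cons (q : ℤ) p : Fin (m + 1) → ℤ) b : ℚ) =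
        q * (Fin.cons 1 η : Fin (m + 1) → ℚ) b := by
      cases b using Fin.cases with
      | zero => simp
      | succ i => simpa using hpq i
    rw [h2] at h1
    simp only [intRat, Pi.smul_apply, smul_eq_mul]
    rw [div_mul_eq_mul_div, h1]; field_simp

lemma infinite_near_rational {m : ℕ} {ξ : Fin m → ℝ}
    (hξ : ξ ∉ Set.range fun (η : Fin m → ℚ) i => (η i : ℝ)) {a : ℕ → ℝ}
    (haρ : ∀ k, a k ≤ netScale m (2 ^ k))
    (h : ∀ K, ∃ k ≥ K, ∃ z ∈ ratPts m ((2 ^ k) ^ m), dist ξ z ≤ a k) :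
    {η : Fin m → ℚ | ∃ k, (fun i => (η i : ℝ)) ∈ ratPts m ((2 ^ k) ^ m) ∧
      dist ξ (fun i => (η i : ℝ)) ≤ a k}.Infinite := by
  intro hfin
  set F := (fun (η : Fin m → ℚ) i => (η i : ℝ)) '' {η : Fin m → ℚ | ∃ k,
    (fun i => (η i : ℝ)) ∈ ratPts m ((2 ^ k) ^ m) ∧ dist ξ (fun i => (η i : ℝ)) ≤ a k} with hF
  have hFc : IsClosed F := (hfin.image _).isClosed
  obtain ⟨ε, hε, hball⟩ := Metric.isOpen_iff.1 hFc.isOpen_compl ξ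
    (fun hmem => hξ (Set.image_subset_range _ _ hmem))
  set C := netScale m (2 ^ 0) with hC
  have htend : Filter.Tendsto (fun k : ℕ => C * (1 / 2 : ℝ) ^ k) Filter.atTop
      (nhds 0) := by
    simpa using (tendsto_pow_atTop_nhds_zero_of_lt_one (r := (1 / 2 : ℝ)) (by norm_num)
      (by norm_num)).const_mul C
  obtain ⟨K, hK⟩ := Filter.eventually_atTop.1 (htend.eventually_lt_const hε)
  obtain ⟨k, hk, z, hz, hd⟩ := h K
  have hak : a k < ε := by
    have h1 := netScale_div_le (m := m) (Nat.zero_le k)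
    rw [div_le_iff₀ (netScale_pos m (by positivity)), Nat.sub_zero] at h1
    calc a k ≤ netScale m (2 ^ k) := haρ k
      _ ≤ C * (1 / 2 : ℝ) ^ k := by rw [mul_comm]; exact h1
      _ < ε := hK k hk
  refine hball (Metric.mem_ball'.2 (hd.trans_lt hak)) ?_
  have hz' := hz
  obtain ⟨q, hq1, hqQ, p, hp⟩ := hz'
  have hzeq : (fun i => (((p i : ℚ) / q : ℚ) : ℝ)) = z := by
    funext i; rw [hp i]; push_cast; rfl
  exact ⟨fun i => (p i : ℚ) / q, ⟨k, by rw [hzeq]; exact hz, by rw [hzeq]; exact hd⟩, hzeq⟩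

lemma mk_mem_Winf {m R : ℕ} {ψ : ℕ → ℝ} (hmono : Antitone ψ) {ξ : Fin m → ℝ}
    (hξ : ξ ∉ Set.range fun (η : Fin m → ℚ) i => (η i : ℝ)) (hR : 1 ≤ R)
    (hRξ : ‖ξ‖ + 4 * 5 ^ m ≤ R)
    (h : ∀ K, ∃ k ≥ K, ∃ z ∈ ratPts m ((2 ^ k) ^ m),
      dist ξ z ≤ min (1 / (2 * (m + 1)) * ψ (R * (2 ^ k) ^ m)) (netScale m (2 ^ k)))
    {s : ℝ} (hs : s ≠ 0) {x : Fin (m + 1) → ℝ} (hx : x ≠ 0)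
    (hxs : x = s • (Fin.cons 1 ξ : Fin (m + 1) → ℝ)) :
    Projectivization.mk ℝ x hx ∈ Winf (m + 1) ψ := by
  have hne : ∀ η : Fin m → ℚ, (Fin.cons 1 η : Fin (m + 1) → ℚ) ≠ 0 := fun η h0 => by
    simpa using congrFun h0 0
  refine Set.infinite_of_injOn_mapsTo (f := fun η : Fin m → ℚ =>
    Projectivization.mk ℚ (Fin.cons 1 η : Fin (m + 1) → ℚ) (hne η)) ?_ ?_
    (infinite_near_rational hξ (fun k => min_le_right _ _) h)
  · intro η _ η' _ heq
    obtain ⟨c, hc⟩ := (Projectivization.mk_eq_mk_iff' ℚ _ _ (hne η) (hne η')).1 heq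
    have hc1 : c = 1 := by simpa using congrFun hc 0
    funext i
    have := congrFun hc i.succ
    simpa [hc1] using this.symm
  · rintro η ⟨k, hη, hd⟩
    have hscale : netScale m (2 ^ k) ≤ 4 * 5 ^ m := by
      unfold netScale
      push_cast
      exact div_le_self (by positivity) (one_le_pow₀ (one_le_pow₀ (by norm_num)))
    obtain ⟨v, t, ht, hprim, hH, hv⟩ := exists_isPrim_smul_cons hR
      (hRξ.trans' (by gcongr)) hη (hd.trans (min_le_right _ _))
    have hv0 : intRat v ≠ 0 := by rw [hv]; exact smul_ne_zero ht (hne η)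
    refine ⟨v, hprim, ⟨hv0, ?_⟩, ?_⟩
    · refine (Projectivization.mk_eq_mk_iff' ℚ _ _ (hne η) hv0).2 ⟨t⁻¹, ?_⟩
      rw [hv, smul_smul, inv_mul_cancel₀ ht, one_smul]
    · obtain ⟨c, hc⟩ := Projectivization.exists_smul_eq_mk_rep ℝ x hx
      have hvr : intReal v = (t : ℝ) • (Fin.cons 1 (fun i => (η i : ℝ)) : Fin (m + 1) → ℝ) := by
        funext b
        have hb : (v b : ℚ) = t * (Fin.cons 1 η : Fin (m + 1) → ℚ) b := congrFun hv b
        have hb' : (v b : ℝ) = t * ((Fin.cons 1 η : Fin (m + 1) → ℚ) b : ℚ) := by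
          exact_mod_cast hb
        simp only [intReal, Pi.smul_apply, smul_eq_mul, hb']
        cases b using Fin.cases <;> simp
      rw [← hc, Units.smul_def, hxs, smul_smul, hvr]
      refine (deltaInf_smul_cons_le (mul_ne_zero c.ne_zero hs) (by exact_mod_cast ht) _ _).trans ?_
      calc _ ≤ 2 * ((m : ℝ) + 1) * (1 / (2 * (m + 1)) * ψ (R * (2 ^ k) ^ m)) := by
            gcongr; exact hd.trans (min_le_left _ _)
        _ = ψ (R * (2 ^ k) ^ m) := by field_simp
        _ ≤ _ := hmono hH

lemma ae_forall_mk_mem_Winf {m : ℕ} (hm : 0 < m) {ψ : ℕ → ℝ} (hψ : ∀ q, 0 ≤ ψ q)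
    (hmono : Antitone ψ) (hdiv : ¬ Summable fun q : ℕ => (q : ℝ) ^ m * ψ q ^ m) :
    ∀ᵐ ξ : Fin m → ℝ, ∀ (s : ℝ) (x : Fin (m + 1) → ℝ) (hx : x ≠ 0), s ≠ 0 →
      x = s • (Fin.cons 1 ξ : Fin (m + 1) → ℝ) →
      Projectivization.mk ℝ x hx ∈ Winf (m + 1) ψ := by
  have : Nonempty (Fin m) := ⟨⟨0, hm⟩⟩
  have hrat : ∀ᵐ ξ : Fin m → ℝ, ξ ∉ Set.range fun (η : Fin m → ℚ) i => (η i : ℝ) :=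
    measure_eq_zero_iff_ae_notMem.1 ((Set.countable_range _).measure_zero volume)
  have hnear : ∀ᵐ ξ : Fin m → ℝ, ∀ R : ℕ, 1 ≤ R → ∀ K, ∃ k ≥ K, ∃ z ∈ ratPts m ((2 ^ k) ^ m),
      dist ξ z ≤ min (1 / (2 * (m + 1)) * ψ (R * (2 ^ k) ^ m)) (netScale m (2 ^ k)) := by
    refine ae_all_iff.2 fun R => ?_
    by_cases hR : 1 ≤ R
    · have hpos : ∀ k, 0 < netScale m (2 ^ k) := fun k => netScale_pos m (by positivity)
      refine (ae_frequently_near_rational hm (fun k => le_min ?_ (hpos k).le)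
        (fun k => min_le_right _ _) (fun k l hkl => min_le_min ?_ ?_)
        (not_summable_min_along_powers hψ hmono hdiv hR (by positivity) hm)).mono
        fun ξ h _ => h
      · have := hψ (R * (2 ^ k) ^ m); positivity
      · have : ψ (R * (2 ^ l) ^ m) ≤ ψ (R * (2 ^ k) ^ m) := hmono (by gcongr; norm_num)
        gcongr
      · exact (div_le_one (hpos k)).1
          ((netScale_div_le hkl).trans (pow_le_one₀ (by norm_num) (by norm_num)))
    · exact Filter.Eventually.of_forall fun _ h => absurd h hR
  filter_upwards [hrat, hnear] with ξ h1 h2 s x hx hs hxs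
  obtain ⟨R, hR⟩ := exists_nat_ge (‖ξ‖ + 4 * 5 ^ m)
  have hR1 : 1 ≤ R := by
    have : (0 : ℝ) < R := lt_of_lt_of_le (by positivity) hR
    exact_mod_cast this
  exact mk_mem_Winf hmono h1 hR1 hR (h2 R hR1) hs hx hxs

/-- A property of almost every point of an affine chart holds on almost every line. -/
lemma ae_cone {m : ℕ} {P : (Fin m → ℝ) → Prop} (hP : ∀ᵐ ξ, P ξ) :
    ∀ᵐ x : Fin (m + 1) → ℝ, x 0 ≠ 0 ∧ P ((x 0)⁻¹ • Fin.tail x) := by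
  set N := toMeasurable volume {ξ : Fin m → ℝ | ¬ P ξ} with hN
  have hN0 : volume N = 0 := by rw [hN, measure_toMeasurable]; exact hP
  have hNm : MeasurableSet N := measurableSet_toMeasurable _ _
  have hprod : ∀ᵐ z : ℝ × (Fin m → ℝ), z.1 ≠ 0 ∧ z.1⁻¹ • z.2 ∉ N := by
    have hmeas : MeasurableSet {z : ℝ × (Fin m → ℝ) | z.1 ≠ 0 ∧ z.1⁻¹ • z.2 ∉ N} := by
      refine (measurable_fst (measurableSet_singleton 0).compl).inter ?_
      exact ((measurable_fst.inv.smul measurable_snd) hNm.compl)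
    rw [Measure.volume_eq_prod, Measure.ae_prod_iff_ae_ae hmeas]
    filter_upwards [Measure.ae_ne volume (0 : ℝ)] with t ht
    have : volume ((fun w : Fin m → ℝ => t⁻¹ • w) ⁻¹' N) = 0 := by
      rw [Measure.addHaar_preimage_smul volume (inv_ne_zero ht), hN0, mul_zero]
    filter_upwards [measure_eq_zero_iff_ae_notMem.1 this] with w hw
    exact ⟨ht, hw⟩
  have := (volume_preserving_piFinSuccAbove (fun _ : Fin (m + 1) => ℝ) 0).quasiMeasurePreserving.ae
    hprod
  filter_upwards [this] with x hx
  refine ⟨hx.1, ?_⟩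
  by_contra h
  exact hx.2 (subset_toMeasurable _ _ h)

lemma continuous_eNorm {n : ℕ} : Continuous (eNorm : (Fin n → ℝ) → ℝ) := by
  unfold eNorm; fun_prop

lemma volume_eNorm_le_one_pos (n : ℕ) : 0 < volume {x : Fin n → ℝ | eNorm x ≤ 1} := by
  have hopen : IsOpen {x : Fin n → ℝ | eNorm x < 1} :=
    isOpen_lt continuous_eNorm continuous_const
  have h0 : (0 : Fin n → ℝ) ∈ {x : Fin n → ℝ | eNorm x < 1} := by simp [eNorm]
  exact (hopen.measure_pos volume ⟨0, h0⟩).trans_le (measure_mono fun x (hx : eNorm x < 1) => hx.le)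

lemma volume_eNorm_le_one_lt_top (n : ℕ) : volume {x : Fin n → ℝ | eNorm x ≤ 1} < ⊤ := by
  refine (measure_mono fun x hx => ?_).trans_lt
    (measure_closedBall_lt_top (x := (0 : Fin n → ℝ)) (r := 1))
  rw [mem_closedBall_zero_iff, pi_norm_le_iff_of_nonneg zero_le_one]
  exact fun i => (abs_le_eNorm x i).trans hx

/-- the projective Khintchine theorem at the infinite place. -/
theorem projective_khintchine_real (n : ℕ) (hn : 2 ≤ n)
    (ψ : ℕ → ℝ) (hψ : ∀ q, 0 ≤ ψ q) (hmono : Antitone ψ)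
    (hdiv : ¬ Summable fun q : ℕ => (q : ℝ) ^ (n - 1) * ψ q ^ (n - 1)) :
    muInf n (Winf n ψ) = 1 := by
  obtain ⟨m, rfl⟩ : ∃ m, n = m + 1 := ⟨n - 1, by omega⟩
  rw [Nat.add_sub_cancel] at hdiv
  have hae : ∀ᵐ x : Fin (m + 1) → ℝ,
      ∃ hx : x ≠ 0, Projectivization.mk ℝ x hx ∈ Winf (m + 1) ψ := by
    filter_upwards [ae_cone (ae_forall_mk_mem_Winf (by omega) hψ hmono hdiv)] with x hx
    obtain ⟨hx0, hW⟩ := hx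
    refine ⟨fun h => hx0 (by rw [h]; rfl), hW (x 0) x _ hx0 (funext fun i => ?_)⟩
    cases i using Fin.cases with
    | zero => simp
    | succ i => simp [Fin.tail, hx0]
  have hnum : volume {x : Fin (m + 1) → ℝ | eNorm x ≤ 1 ∧
      ∃ hx : x ≠ 0, Projectivization.mk ℝ x hx ∈ Winf (m + 1) ψ} =
      volume {x : Fin (m + 1) → ℝ | eNorm x ≤ 1} := by
    refine measure_congr ?_
    filter_upwards [hae] with x hx
    exact propext (and_iff_left hx)
  unfold muInf
  rw [hnum, ENNReal.div_self (volume_eNorm_le_one_pos _).ne' (volume_eNorm_le_one_lt_top _).ne]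
end

section
/- Let n ≥ 2, let p be a prime, let k ≥ 1 be an integer, and let y ∈ ℤ_p^n with |y|_p = 1. Then the closed ball of radius p^{-k} around φ(y) in the projective metric satisfies B_δ(φ(y), p^{-k}) = φ({x ∈ ℤ_p^n : |x − y|_p ≤ p^{-k}}), where B_δ(φ(y), p^{-k}) := {z ∈ ℙ^{n-1}(ℚ_p) : δ_p(z, φ(y)) ≤ p^{-k}}. -/
open MeasureTheory

/-- For `‖y‖ = 1`, a bound on the projective distance is a bound on all `2 × 2` minors. -/
theorem padicDelta_le_iff {p : ℕ} [Fact p.Prime] {n : ℕ} {w y : Fin n → ℚ_[p]} (hw : w ≠ 0)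
    (hy : ‖y‖ = 1) {r : ℝ} (hr : 0 ≤ r) :
    padicDelta p w y ≤ r ↔ ∀ i j, ‖w i * y j - w j * y i‖ ≤ r * ‖w‖ := by
  have hw' : 0 < ‖w‖ := norm_pos_iff.2 hw
  rw [padicDelta, hy, mul_one, div_le_iff₀ hw']
  refine ⟨fun h i j => ?_, fun h => Real.iSup_le (fun ij => h ij.1 ij.2) (by positivity)⟩
  exact (le_ciSup (f := fun ij : Fin n × Fin n => ‖w ij.1 * y ij.2 - w ij.2 * y ij.1‖)
    (Set.finite_range _).bddAbove (i, j)).trans h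

/-- The sup norm of a nonzero vector is attained at some coordinate. -/
theorem exists_norm_apply_eq_norm_s7 {p : ℕ} [Fact p.Prime] {n : ℕ} {w : Fin n → ℚ_[p]}
    (hw : w ≠ 0) : ∃ i, ‖w i‖ = ‖w‖ := by
  have : Nonempty (Fin n) := by
    by_contra h
    rw [not_nonempty_iff] at h
    exact hw (Subsingleton.elim _ _)
  obtain ⟨i, hi⟩ := Finite.exists_max fun i => ‖w i‖
  exact ⟨i, le_antisymm (norm_le_pi_norm w i) ((pi_norm_le_iff_of_nonempty _).2 hi)⟩

/-- If `w` is at projective distance less than one from `y`, then `w` attains its norm wherever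
the unit vector `y` does. -/
theorem norm_apply_eq_norm_of_minors_le {p : ℕ} [Fact p.Prime] {n : ℕ} {w y : Fin n → ℚ_[p]}
    (hw : w ≠ 0) (hy : ‖y‖ = 1) {r : ℝ} (hr : r < 1)
    (h : ∀ i j, ‖w i * y j - w j * y i‖ ≤ r * ‖w‖) {j : Fin n} (hj : ‖y j‖ = 1) :
    ‖w j‖ = ‖w‖ := by
  have hw' : 0 < ‖w‖ := norm_pos_iff.2 hw
  refine le_antisymm (norm_le_pi_norm w j) (not_lt.1 fun hlt => ?_)
  obtain ⟨i, hi⟩ := exists_norm_apply_eq_norm_s7 hw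
  have h1 : ‖w i * y j - w j * y i‖ < ‖w‖ := (h i j).trans_lt (by nlinarith)
  have h2 : ‖w j * y i‖ < ‖w‖ := by
    rw [norm_mul]
    have := norm_le_pi_norm y i
    nlinarith [norm_nonneg (w j)]
  have h3 := (Padic.nonarchimedean (w i * y j - w j * y i) (w j * y i)).trans_lt
    (max_lt h1 h2)
  rw [sub_add_cancel, norm_mul, hj, mul_one, hi] at h3
  exact h3.false

/-- characterization of projective balls: for `y ∈ ℤ_p^n` with `|y|_p = 1`,
`B_δ(φ(y), p^{-k}) = φ({x ∈ ℤ_p^n : |x − y|_p ≤ p^{-k}})`. -/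
theorem projective_ball_eq (n p : ℕ) (hn : 2 ≤ n) [Fact p.Prime] (k : ℕ) (hk : 1 ≤ k)
    (y : Fin n → ℚ_[p]) (hy : ‖y‖ = 1) :
    Bdelta p y ((p : ℝ) ^ (-(k : ℤ))) =
      {z | ∃ x : Fin n → ℚ_[p], (∀ i, ‖x i‖ ≤ 1) ∧ ‖x - y‖ ≤ (p : ℝ) ^ (-(k : ℤ)) ∧
        ∃ hx : x ≠ 0, z = Projectivization.mk ℚ_[p] x hx} := by
  have hp : (1 : ℝ) < p := by exact_mod_cast (Fact.out : p.Prime).one_lt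
  have hr0 : (0 : ℝ) ≤ (p : ℝ) ^ (-(k : ℤ)) := by positivity
  have hr1 : (p : ℝ) ^ (-(k : ℤ)) < 1 := zpow_lt_one_of_neg₀ hp (by lia)
  generalize (p : ℝ) ^ (-(k : ℤ)) = r at hr0 hr1 ⊢
  have hy0 : y ≠ 0 := by
    rintro rfl
    simp at hy
  ext z
  rw [Bdelta, Set.mem_ofPred_eq, Set.mem_ofPred_eq, padicDelta_le_iff z.rep_nonzero hy hr0]
  constructor
  · intro h
    obtain ⟨j, hj⟩ := exists_norm_apply_eq_norm_s7 hy0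
    rw [hy] at hj
    have hwj := norm_apply_eq_norm_of_minors_le z.rep_nonzero hy hr1 h hj
    have hwpos : 0 < ‖z.rep‖ := norm_pos_iff.2 z.rep_nonzero
    have hwj0 : z.rep j ≠ 0 := norm_pos_iff.1 (hwj ▸ hwpos)
    have hyj0 : y j ≠ 0 := norm_pos_iff.1 (hj ▸ one_pos)
    have ha : y j / z.rep j ≠ 0 := div_ne_zero hyj0 hwj0
    refine ⟨(y j / z.rep j) • z.rep, fun i => ?_, (pi_norm_le_iff_of_nonneg hr0).2 fun i => ?_,
      smul_ne_zero ha z.rep_nonzero, ?_⟩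
    · rw [Pi.smul_apply, smul_eq_mul, norm_mul, norm_div, hj, hwj, one_div_mul_eq_div]
      exact div_le_one_of_le₀ (norm_le_pi_norm _ i) hwpos.le
    · have : ((y j / z.rep j) • z.rep - y) i =
          (z.rep i * y j - z.rep j * y i) / z.rep j := by
        simp only [Pi.sub_apply, Pi.smul_apply, smul_eq_mul]
        field_simp
      rw [this, norm_div, hwj, div_le_iff₀ hwpos]
      exact h i j
    · conv_lhs => rw [← z.mk_rep]
      rw [Projectivization.mk_eq_mk_iff']
      exact ⟨(y j / z.rep j)⁻¹, inv_smul_smul₀ ha _⟩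
  · rintro ⟨x, -, hxy, hx, rfl⟩
    obtain ⟨a, ha⟩ := Projectivization.exists_smul_eq_mk_rep ℚ_[p] x hx
    have hx1 : 1 ≤ ‖x‖ := by
      obtain ⟨j, hj⟩ := exists_norm_apply_eq_norm_s7 hy0
      refine le_trans (not_lt.1 fun hlt => ?_) (norm_le_pi_norm x j)
      have h1 : ‖y j - x j‖ < 1 := by
        rw [norm_sub_rev]
        exact ((norm_le_pi_norm (x - y) j).trans hxy).trans_lt hr1
      have h2 := (Padic.nonarchimedean (y j - x j) (x j)).trans_lt (max_lt h1 hlt)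
      rw [sub_add_cancel, hj, hy] at h2
      exact h2.false
    have hterm : ∀ i j, ‖(x i - y i) * y j‖ ≤ r := fun i j => by
      rw [norm_mul]
      have h1 : ‖x i - y i‖ ≤ r := (norm_le_pi_norm (x - y) i).trans hxy
      have h2 : ‖y j‖ ≤ 1 := hy ▸ norm_le_pi_norm y j
      exact (mul_le_of_le_one_right (norm_nonneg _) h2).trans h1
    intro i j
    rw [← ha]
    have hmin : (a • x) i * y j - (a • x) j * y i =
        (a : ℚ_[p]) * ((x i - y i) * y j - (x j - y j) * y i) := by
      simp only [Pi.smul_apply, Units.smul_def, smul_eq_mul]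
      ring
    have hsub : ‖(x i - y i) * y j - (x j - y j) * y i‖ ≤ r := by
      rw [sub_eq_add_neg]
      refine (Padic.nonarchimedean _ _).trans (max_le (hterm i j) ?_)
      rw [norm_neg]
      exact hterm j i
    rw [hmin, norm_mul, Units.smul_def, norm_smul, mul_left_comm]
    exact mul_le_mul_of_nonneg_left (hsub.trans (le_mul_of_one_le_right hr0 hx1)) (norm_nonneg _)
end
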